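/- Let m ≥ 3 be an integer, let n ≥ 5, and let a₁,…,aₙ be positive integers. Then the m-gonal form ⟨a₁,…,aₙ⟩_m is almost regular over ℕ₀: the set of positive integers that are locally represented by ⟨a₁,…,aₙ⟩_m but not represented by ⟨a₁,…,aₙ⟩_m over ℕ₀ is finite. -/

import Mathlib

/-- The `x`-th `m`-gonal number `P_m(x) = ((m-2)/2)(x² - x) + x`.
Since `x * (x - 1)` is always even, the integer division by `2` is exact. -/
def polyNum (m x : ℤ) : ℤ := (m - 2) * (x * (x - 1)) / 2 + x


section
lemma hensel_quad (p : ℕ) (hp : p.Prime) (b c x L : ℤ) (s : ℕ)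
    (h1 : ¬ (p:ℤ)^(s+1) ∣ 2*b*x+c) (h2 : (p:ℤ)^(2*s+1) ∣ b*x^2+c*x-L) (k : ℕ) :
    ∃ y : ℤ, ¬ (p:ℤ)^(s+1) ∣ 2*b*y+c ∧ (p:ℤ)^k ∣ b*y^2+c*y-L := by
  have hpp : Prime (p:ℤ) := Nat.prime_iff_prime_int.mp hp
  have hp0 : (p:ℤ) ≠ 0 := hpp.ne_zero
  -- exact valuation
  obtain ⟨v, hvs, u, hu, hpu⟩ : ∃ v ≤ s, ∃ u : ℤ, 2*b*x+c = p^v*u ∧ ¬ (p:ℤ) ∣ u := by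
    have hne : 2*b*x+c ≠ 0 := by
      intro h; rw [h] at h1; exact h1 (dvd_zero _)
    have hfin : FiniteMultiplicity (p:ℤ) (2*b*x+c) :=
      Int.finiteMultiplicity_iff.mpr ⟨by simpa using hp.ne_one, hne⟩
    obtain ⟨u, hu, hpu⟩ := hfin.exists_eq_pow_mul_and_not_dvd
    refine ⟨_, ?_, u, hu, hpu⟩
    by_contra hlt
    push Not at hlt
    exact h1 ((pow_dvd_pow _ hlt).trans ⟨u, hu⟩)
  suffices H : ∀ j, ∃ y u : ℤ, 2*b*y+c = p^v*u ∧ ¬ (p:ℤ) ∣ u ∧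
      (p:ℤ)^(2*v+1+j) ∣ b*y^2+c*y-L by
    obtain ⟨y, u, hy, hu, hd⟩ := H k
    refine ⟨y, ?_, (pow_dvd_pow _ (by omega)).trans hd⟩
    intro hd
    have : (p:ℤ)^(v+1) ∣ p^v*u := by
      rw [← hy]; exact (pow_dvd_pow _ (by omega)).trans hd
    rw [pow_succ] at this
    exact hu ((mul_dvd_mul_iff_left (pow_ne_zero _ hp0)).mp this)
  intro j
  induction j with
  | zero => exact ⟨x, u, hu, hpu, (pow_dvd_pow _ (by omega)).trans h2⟩
  | succ j ih =>
    obtain ⟨y, u, hy, hu, w, hw⟩ := ih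
    have hcop : IsCoprime u (p:ℤ) := ((hpp.coprime_iff_not_dvd).mpr hu).symm
    obtain ⟨α, β, hab⟩ := hcop
    refine ⟨y + (-w*α) * p^(v+1+j), u + 2*b*(-w*α)*p^(1+j), ?_, ?_, ?_⟩
    · linear_combination hy
    · intro hd
      apply hu
      have : (p:ℤ) ∣ 2*b*(-w*α)*p^(1+j) := Dvd.dvd.mul_left (dvd_pow_self _ (by omega)) _
      exact (dvd_add_left this).mp hd
    · have : b * (y + (-w*α) * p^(v+1+j))^2 + c*(y + (-w*α) * p^(v+1+j)) - L
        = p^(2*v+1+(j+1)) * (w*β + b*(w*α)^2*p^j) := by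
        have e : b * (y + (-w*α) * p^(v+1+j))^2 + c*(y + (-w*α) * p^(v+1+j)) - L
          = (b*y^2+c*y-L) + (-w*α) * p^(v+1+j)*(2*b*y+c) + b*((-w*α) * p^(v+1+j))^2 := by ring
        rw [e, hw, hy]
        have hβ : β * p = 1 - α * u := by linear_combination hab
        ring_nf
        linear_combination (-(p:ℤ)^(v*2) * p^j * p * w) * hβ
      rw [this]; exact dvd_mul_right _ _

/-- normal form -/
lemma normal_form (p : ℕ) (hp : p.Prime) (b : Fin 5 → ℤ) (hb : ∀ i, b i ≠ 0) :
    ∃ (T : ℕ) (f : Fin 5 → ℕ) (v : Fin 5 → ℤ), (∀ j, b j * p^(2*f j) = p^T * v j) ∧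
      (∀ j, ¬ (p:ℤ) ∣ v j ∨ ∃ u, v j = p*u ∧ ¬ (p:ℤ) ∣ u) ∧
      ∃ i j k, i ≠ j ∧ j ≠ k ∧ i ≠ k ∧ ¬ (p:ℤ) ∣ v i ∧ ¬ (p:ℤ) ∣ v j ∧ ¬ (p:ℤ) ∣ v k := by
  have hfin : ∀ i, ∃ (m : ℕ) (u : ℤ), b i = p^m*u ∧ ¬ (p:ℤ) ∣ u := by
    intro i
    have hfin : FiniteMultiplicity (p:ℤ) (b i) :=
      Int.finiteMultiplicity_iff.mpr ⟨by simpa using hp.ne_one, hb i⟩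
    obtain ⟨u, hu, hpu⟩ := hfin.exists_eq_pow_mul_and_not_dvd
    exact ⟨_, u, hu, hpu⟩
  choose m u hu hpu using hfin
  have key : ∀ d : Fin 5 → Bool, ∃ D : Bool, ∃ i j k, i ≠ j ∧ j ≠ k ∧ i ≠ k ∧
    d i = D ∧ d j = D ∧ d k = D := by decide
  obtain ⟨D, i, j, k, hij, hjk, hik, hi, hj, hk⟩ := key (fun i => decide (m i % 2 = 1))
  set E := ∑ i, m i with hE
  have hle : ∀ i, m i ≤ E := fun i => Finset.single_le_sum (f := m) (fun _ _ => Nat.zero_le _) (Finset.mem_univ i)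
  -- T ≡ D mod 2
  set T := 2*E + (if D then 1 else 0) with hT
  have hTD : T % 2 = if D then 1 else 0 := by
    rw [hT]; split_ifs <;> omega
  have hTE : 2*E ≤ T := by rw [hT]; omega
  refine ⟨T, fun j => (T + 1 - m j)/2, fun j => if m j % 2 = T % 2 then u j else p * u j, ?_, ?_, i, j, k, hij, hjk, hik, ?_⟩
  · intro j
    have := hle j
    simp only
    split_ifs with h
    · have : m j + 2*((T+1-m j)/2) = T := by omega
      calc b j * p^(2*((T+1-m j)/2)) = p^(m j + 2*((T+1-m j)/2)) * u j := by
            nth_rw 1 [hu j]; ring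
        _ = _ := by rw [this]
    · have : m j + 2*((T+1-m j)/2) = T+1 := by omega
      calc b j * p^(2*((T+1-m j)/2)) = p^(m j + 2*((T+1-m j)/2)) * u j := by
            nth_rw 1 [hu j]; ring
        _ = _ := by rw [this]; ring
  · intro j
    simp only
    split_ifs with h
    · exact Or.inl (hpu j)
    · exact Or.inr ⟨u j, rfl, hpu j⟩
  · have aux : ∀ i, decide (m i % 2 = 1) = D → m i % 2 = T % 2 := by
      intro i hi
      rw [hTD, ← hi]
      by_cases h : m i % 2 = 1
      · simp [h]
      · simp [h]; omega
    simp only [aux i hi, aux j hj, aux k hk, if_true]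
    exact ⟨hpu _, hpu _, hpu _⟩
end

section
lemma sum_three (v : Fin 5 → ℤ) (i j k : Fin 5) (hij : i ≠ j) (hjk : j ≠ k) (hik : i ≠ k) (a b c : ℤ) :
    ∃ y : Fin 5 → ℤ, y i = a ∧ y j = b ∧ y k = c ∧
    ∑ t, v t * y t^2 = v i * a^2 + v j * b^2 + v k * c^2 := by
  refine ⟨fun t => if t = i then a else if t = j then b else if t = k then c else 0, ?_, ?_, ?_, ?_⟩
  · simp
  · simp [hij.symm]
  · simp [hik.symm, hjk.symm]
  · have : ∀ t, v t * (if t = i then a else if t = j then b else if t = k then c else 0)^2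
      = (if t = i then v i * a^2 else 0) + (if t = j then v j * b^2 else 0) + (if t = k then v k * c^2 else 0) := by
      intro t
      by_cases h1 : t = i
      · subst h1; simp [hij, hik]
      · by_cases h2 : t = j
        · subst h2; simp [h1, hjk]
        · by_cases h3 : t = k
          · subst h3; simp [h1, h2]
          · simp [h1, h2, h3]
    simp_rw [this, Finset.sum_add_distrib]
    simp

lemma sum_four (v : Fin 5 → ℤ) (i j k l : Fin 5) (hij : i ≠ j) (hjk : j ≠ k) (hik : i ≠ k)
    (hli : l ≠ i) (hlj : l ≠ j) (hlk : l ≠ k) (a b c d : ℤ) :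
    ∃ y : Fin 5 → ℤ, y i = a ∧ y j = b ∧ y k = c ∧ y l = d ∧
    ∑ t, v t * y t^2 = v i * a^2 + v j * b^2 + v k * c^2 + v l * d^2 := by
  obtain ⟨y, h1, h2, h3, h4⟩ := sum_three (fun t => if t = l then 0 else v t) i j k hij hjk hik a b c
  refine ⟨Function.update y l d, ?_, ?_, ?_, ?_, ?_⟩
  · simp [hli.symm, h1]
  · simp [hlj.symm, h2]
  · simp [hlk.symm, h3]
  · simp
  · simp only [hli.symm, hlj.symm, hlk.symm, if_false] at h4
    rw [← h4]
    have : ∀ t, v t * (Function.update y l d t)^2 = (if t = l then 0 else v t) * y t^2 + (if t = l then v l * d^2 else 0) := by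
      intro t
      by_cases h : t = l
      · subst h; simp
      · simp [h]
    simp_rw [this, Finset.sum_add_distrib]
    simp

lemma core_odd (p : ℕ) (hp : p.Prime) (hp2 : p ≠ 2) (v : Fin 5 → ℤ)
    (i j k : Fin 5) (hij : i ≠ j) (hjk : j ≠ k) (hik : i ≠ k) (hi : ¬ (p:ℤ) ∣ v i)
    (hj : ¬ (p:ℤ) ∣ v j) (hk : ¬ (p:ℤ) ∣ v k) :
    ∃ (y : Fin 5 → ℤ) (i : Fin 5) (τ : ℕ), ¬ (p:ℤ)^(τ+1) ∣ 2 * v i * y i ∧ (p:ℤ)^(2*τ+1) ∣ ∑ t, v t * y t^2 := by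
  have := Fact.mk hp
  have hi' : ((v i : ℤ) : ZMod p) ≠ 0 := by rwa [Ne, ZMod.intCast_zmod_eq_zero_iff_dvd]
  have hj' : ((v j : ℤ) : ZMod p) ≠ 0 := by rwa [Ne, ZMod.intCast_zmod_eq_zero_iff_dvd]
  open Polynomial in
  obtain ⟨a, b, hab⟩ : ∃ a b : ZMod p, (v i : ZMod p) * a^2 + ((v j : ZMod p) * b^2 + (v k : ZMod p)) = 0 := by
    have := FiniteField.exists_root_sum_quadratic (R := ZMod p) (f := C (v i : ZMod p) * X^2 + C 0 * X + C 0)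
      (g := C (v j : ZMod p) * X^2 + C 0 * X + C (v k : ZMod p))
      (Polynomial.degree_quadratic hi') (Polynomial.degree_quadratic hj')
      (by rw [ZMod.card]; exact hp.eq_two_or_odd.resolve_left hp2)
    obtain ⟨a, b, h⟩ := this
    refine ⟨a, b, ?_⟩
    simpa using h
  obtain ⟨y, h1, h2, h3, h4⟩ := sum_three v i j k hij hjk hik (a.val:ℤ) (b.val:ℤ) 1
  refine ⟨y, k, 0, ?_, ?_⟩
  · rw [h3]
    have hpp : Prime (p:ℤ) := Nat.prime_iff_prime_int.mp hp
    simp only [zero_add, pow_one, mul_one]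
    intro h
    rcases hpp.dvd_or_dvd h with h | h
    · have := (Nat.prime_dvd_prime_iff_eq hp Nat.prime_two).mp (by exact_mod_cast h)
      exact hp2 this
    · exact hk h
  · rw [h4]
    simp only [mul_zero, zero_add, pow_one]
    rw [← ZMod.intCast_zmod_eq_zero_iff_dvd]
    push_cast
    simp only [ZMod.natCast_val, ZMod.cast_id', id]
    linear_combination hab

lemma core_two (v : Fin 5 → ℤ) (hv : (∀ j, ¬ (2:ℤ) ∣ v j ∨ ∃ u, v j = 2*u ∧ ¬ (2:ℤ) ∣ u) )
    (i j k : Fin 5) (hij : i ≠ j) (hjk : j ≠ k) (hik : i ≠ k) (hi : ¬ (2:ℤ) ∣ v i)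
    (hj : ¬ (2:ℤ) ∣ v j) (hk : ¬ (2:ℤ) ∣ v k) :
    ∃ (y : Fin 5 → ℤ) (i : Fin 5) (τ : ℕ), ¬ (2:ℤ)^(τ+1) ∣ 2 * v i * y i ∧ (2:ℤ)^(2*τ+1) ∣ ∑ t, v t * y t^2 := by
  by_cases hall : ∀ j, ¬ (2:ℤ) ∣ v j
  · have h0 := hall 0
    have h1 := hall 1
    have h2 := hall 2
    have h3 := hall 3
    have h4 := hall 4
    have key : ∃ a b c d : ℤ, 8 ∣ v 0 + v 1 * a^2 + v 2 * b^2 + v 3 * c^2 + v 4 * d^2 := by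
      have : 8 ∣ v 0 + v 1 ∨ 8 ∣ v 0 + v 1 + v 2 * 4 ∨ 8 ∣ v 0 + v 2 ∨ 8 ∣ v 0 + v 2 + v 1 * 4
        ∨ 8 ∣ v 0 + v 3 ∨ 8 ∣ v 0 + v 3 + v 1 * 4 ∨ 8 ∣ v 0 + v 1 + v 2 + v 3 ∨ 8 ∣ v 0 + v 1 + v 2 + v 3 + v 4 * 4 := by
        have aux : ∀ a b : ℤ, 4 ∣ a → ¬ 2 ∣ b → 8 ∣ a ∨ 8 ∣ a + b * 4 := by intro a b; omega
        by_cases c1 : 4 ∣ v 0 + v 1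
        · have := aux _ _ c1 h2; tauto
        by_cases c2 : 4 ∣ v 0 + v 2
        · have := aux _ _ c2 h1; tauto
        by_cases c3 : 4 ∣ v 0 + v 3
        · have := aux _ _ c3 h1; tauto
        have := aux (v 0 + v 1 + v 2 + v 3) _ (by omega) h4; tauto
      rcases this with h | h | h | h | h | h | h | h
      · exact ⟨1, 0, 0, 0, by simpa using h⟩
      · exact ⟨1, 2, 0, 0, by norm_num; exact h⟩
      · exact ⟨0, 1, 0, 0, by simpa using h⟩
      · exact ⟨2, 1, 0, 0, by norm_num; omega⟩
      · exact ⟨0, 0, 1, 0, by simpa using h⟩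
      · exact ⟨2, 0, 1, 0, by norm_num; omega⟩
      · exact ⟨1, 1, 1, 0, by norm_num; omega⟩
      · exact ⟨1, 1, 1, 2, by norm_num; omega⟩
    obtain ⟨a, b, c, d, h⟩ := key
    refine ⟨![1, a, b, c, d], 0, 1, ?_, ?_⟩
    · simp; omega
    · simp [Fin.sum_univ_five]; exact h
  · push Not at hall
    obtain ⟨l, hl⟩ := hall
    have hli : l ≠ i := by rintro rfl; exact hi hl
    have hlj : l ≠ j := by rintro rfl; exact hj hl
    have hlk : l ≠ k := by rintro rfl; exact hk hl
    obtain ⟨u, hu, hu2⟩ := (hv l).resolve_left (fun h => h hl)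
    have key : ∃ c d : ℤ, 8 ∣ v i * 1^2 + v j * 1^2 + v k * c^2 + v l * d^2 := by
      have : 8 ∣ v i + v j ∨ 8 ∣ v i + v j + v k * 4 ∨ 8 ∣ v i + v j + v l ∨ 8 ∣ v i + v j + v l + v k * 4 := by
        have aux : ∀ a b : ℤ, 4 ∣ a → ¬ 2 ∣ b → 8 ∣ a ∨ 8 ∣ a + b * 4 := by intro a b; omega
        by_cases c1 : 4 ∣ v i + v j
        · have := aux _ _ c1 hk; tauto
        have := aux (v i + v j + v l) _ (by omega) hk; tauto
      rcases this with h | h | h | h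
      · exact ⟨0, 0, by simpa using h⟩
      · exact ⟨2, 0, by norm_num; exact h⟩
      · exact ⟨0, 1, by norm_num; exact h⟩
      · exact ⟨2, 1, by norm_num; convert h using 1; ring⟩
    obtain ⟨c, d, h⟩ := key
    obtain ⟨y, h1, h2, h3, h4, h5⟩ := sum_four v i j k l hij hjk hik hli hlj hlk 1 1 c d
    refine ⟨y, i, 1, ?_, ?_⟩
    · rw [h1]; norm_num; omega
    · rw [h5]; norm_num at h ⊢; exact h

lemma isotropic (p : ℕ) (hp : p.Prime) (b : Fin 5 → ℤ) (hb : ∀ i, b i ≠ 0) :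
    ∃ (z : Fin 5 → ℤ) (i : Fin 5) (s : ℕ), ¬ (p:ℤ)^(s+1) ∣ 2 * b i * z i ∧
      (p:ℤ)^(2*s+1) ∣ ∑ t, b t * z t^2 := by
  obtain ⟨T, f, v, hbv, hv, i, j, k, hij, hjk, hik, hi, hj, hk⟩ := normal_form p hp b hb
  have hpp : Prime (p:ℤ) := Nat.prime_iff_prime_int.mp hp
  have core : ∃ (y : Fin 5 → ℤ) (i : Fin 5) (τ : ℕ), ¬ (p:ℤ)^(τ+1) ∣ 2 * v i * y i ∧ (p:ℤ)^(2*τ+1) ∣ ∑ t, v t * y t^2 := by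
    by_cases h2 : p = 2
    · subst h2
      exact core_two v hv i j k hij hjk hik hi hj hk
    · exact core_odd p hp h2 v i j k hij hjk hik hi hj hk
  obtain ⟨y, i, τ, hy, hd⟩ := core
  have hsum : ∀ a : ℤ, ∑ t, v t * (Function.update y i a t)^2 = v i * a^2 + ∑ t ∈ Finset.univ.erase i, v t * y t^2 := by
    intro a
    rw [← Finset.add_sum_erase _ _ (Finset.mem_univ i)]
    congr 1
    · simp
    · apply Finset.sum_congr rfl
      intro t ht
      rw [Function.update_of_ne (Finset.ne_of_mem_erase ht)]
  obtain ⟨a, ha1, ha2⟩ := hensel_quad p hp (v i) 0 (y i) (-∑ t ∈ Finset.univ.erase i, v t * y t^2) τ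
    (by simpa using hy) (by
      have := hsum (y i)
      rw [Function.update_eq_self] at this
      rw [this] at hd
      convert hd using 1; ring) (2*(T+τ)+1)
  have hd' : (p:ℤ)^(2*(T+τ)+1) ∣ ∑ t, v t * (Function.update y i a t)^2 := by
    rw [hsum a]; convert ha2 using 1; ring
  refine ⟨fun t => p^(f t) * Function.update y i a t, i, T+τ, ?_, ?_⟩
  · simp only [Function.update_self]
    intro h
    apply ha1
    have h2 : (p:ℤ)^T * p^(τ+1) ∣ p^T * (2 * v i * a) := by
      have : (p:ℤ)^T * (2 * v i * a) = p^(f i) * (2 * b i * (p^(f i) * a)) := by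
        linear_combination (-2*a) * hbv i
      rw [this, ← pow_add]
      exact Dvd.dvd.mul_left h _
    simpa using (mul_dvd_mul_iff_left (pow_ne_zero _ hpp.ne_zero)).mp h2
  · have : ∑ t, b t * (p^(f t) * Function.update y i a t)^2 = p^T * ∑ t, v t * (Function.update y i a t)^2 := by
      rw [Finset.mul_sum]
      apply Finset.sum_congr rfl
      intro t _
      linear_combination (Function.update y i a t)^2 * hbv t
    rw [this]
    exact Dvd.dvd.mul_left hd' _

def qf (b c x : Fin 5 → ℤ) : ℤ := ∑ i, (b i * x i^2 + c i * x i)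

lemma local_sol (p : ℕ) (hp : p.Prime) (b c : Fin 5 → ℤ) (hb : ∀ i, b i ≠ 0) :
    ∃ e : ℕ, ∀ L : ℤ, (∃ x, (p:ℤ)^e ∣ qf b c x - L) → ∃ x i s, s ≤ e ∧
      ¬ (p:ℤ)^(s+1) ∣ 2 * b i * x i + c i ∧ (p:ℤ)^(2*s+1) ∣ qf b c x - L := by
  obtain ⟨z, i, s, h1, h2⟩ := isotropic p hp b hb
  refine ⟨4*s+1, fun L ⟨x, hx⟩ => ?_⟩
  by_cases hall : ∀ i, (p:ℤ)^(2*s+1) ∣ 2 * b i * x i + c i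
  · refine ⟨x + z, i, s, by omega, ?_, ?_⟩
    · intro h
      apply h1
      have h3 : (p:ℤ)^(s+1) ∣ 2 * b i * x i + c i := (pow_dvd_pow _ (by omega)).trans (hall i)
      have := dvd_sub h h3
      have e : 2 * b i * (x + z) i + c i - (2 * b i * x i + c i) = 2 * b i * z i := by
        rw [Pi.add_apply]; ring
      rwa [e] at this
    · have : qf b c (x+z) - L = (qf b c x - L) + (∑ i, (2 * b i * x i + c i) * z i) + ∑ t, b t * z t^2 := by
        have h : qf b c (x+z) = qf b c x + (∑ i, (2 * b i * x i + c i) * z i) + ∑ t, b t * z t^2 := by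
          unfold qf
          rw [← Finset.sum_add_distrib, ← Finset.sum_add_distrib]
          apply Finset.sum_congr rfl
          intro t _
          simp only [Pi.add_apply]; ring
        rw [h]; ring
      rw [this]
      refine dvd_add (dvd_add ((pow_dvd_pow _ (by omega)).trans hx) ?_) h2
      exact Finset.dvd_sum fun i _ => Dvd.dvd.mul_right (hall i) _
  · push Not at hall
    obtain ⟨i, hi⟩ := hall
    exact ⟨x, i, 2*s, by omega, hi, (pow_dvd_pow _ (by omega)).trans hx⟩
end

section
/-- number of solutions mod q -/
noncomputable def rho (b c : Fin 5 → ℤ) (L : ℤ) (q : ℕ) : ℕ :=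
  Nat.card {x : Fin 5 → ZMod q // ∑ i, ((b i : ZMod q) * x i^2 + (c i : ZMod q) * x i) = (L : ZMod q)}

lemma rho_mul (b c : Fin 5 → ℤ) (L : ℤ) (u v : ℕ) (huv : Nat.Coprime u v) :
    rho b c L (u*v) = rho b c L u * rho b c L v := by
  unfold rho
  rw [← Nat.card_prod]
  let φ := ZMod.chineseRemainder huv
  let e : (Fin 5 → ZMod (u*v)) ≃ (Fin 5 → ZMod u) × (Fin 5 → ZMod v) :=
    { toFun := fun x => (fun i => (φ (x i)).1, fun i => (φ (x i)).2)
      invFun := fun y i => φ.symm (y.1 i, y.2 i)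
      left_inv := fun x => by ext i; simp
      right_inv := fun y => by ext i <;> simp }
  refine Nat.card_congr ((e.subtypeEquiv (q := fun y =>
    (∑ i, ((b i : ZMod u) * y.1 i^2 + (c i : ZMod u) * y.1 i) = (L : ZMod u)) ∧
    (∑ i, ((b i : ZMod v) * y.2 i^2 + (c i : ZMod v) * y.2 i) = (L : ZMod v))) ?_).trans
    (Equiv.subtypeProdEquivProd
      (p := fun y : Fin 5 → ZMod u => ∑ i, ((b i : ZMod u) * y i^2 + (c i : ZMod u) * y i) = (L : ZMod u))
      (q := fun y : Fin 5 → ZMod v => ∑ i, ((b i : ZMod v) * y i^2 + (c i : ZMod v) * y i) = (L : ZMod v))))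
  intro x
  rw [← φ.injective.eq_iff, Prod.ext_iff]
  simp [e, Prod.fst_sum, Prod.snd_sum]

lemma rho_pow (p : ℕ) (hp : p.Prime) (b c : Fin 5 → ℤ) (L : ℤ) (x : Fin 5 → ℤ) (i : Fin 5) (s : ℕ)
    (h1 : ¬ (p:ℤ)^(s+1) ∣ 2 * b i * x i + c i) (h2 : (p:ℤ)^(2*s+1) ∣ qf b c x - L) (k : ℕ) :
    (p^(k-(2*s+1)))^4 ≤ rho b c L (p^k) := by
  have hpp : Prime (p:ℤ) := Nat.prime_iff_prime_int.mp hp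
  have : NeZero (p^k) := ⟨pow_ne_zero _ hp.ne_zero⟩
  let X := {j : Fin 5 // j ≠ i} → Fin (p^(k-(2*s+1)))
  have hX : Nat.card X = (p^(k-(2*s+1)))^4 := by
    simp only [X, Nat.card_eq_fintype_card, Fintype.card_fun, Fintype.card_fin]
    congr 1
    simp
  rw [← hX]
  have hsplit : ∀ y : Fin 5 → ℤ, qf b c y = (b i * y i^2 + c i * y i) + ∑ t ∈ Finset.univ.erase i, (b t * y t^2 + c t * y t) := by
    intro y
    unfold qf
    rw [Finset.add_sum_erase _ (fun t => (b t * y t^2 + c t * y t)) (Finset.mem_univ i)]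
  have hex : ∀ w : X, ∃ y : Fin 5 → ℤ, (∀ j : {j : Fin 5 // j ≠ i}, y j = x j + (p:ℤ)^(2*s+1) * (w j : ℕ)) ∧
      (p:ℤ)^k ∣ qf b c y - L := by
    intro w
    let y0 : Fin 5 → ℤ := fun j => if h : j ≠ i then x j + (p:ℤ)^(2*s+1) * (w ⟨j, h⟩ : ℕ) else x i
    have hy0i : y0 i = x i := by simp [y0]
    have hy0 : ∀ j, (p:ℤ)^(2*s+1) ∣ y0 j - x j := by
      intro j
      by_cases h : j ≠ i
      · simp [y0, h]
      · push Not at h; subst h; simp [y0]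
    have hq : (p:ℤ)^(2*s+1) ∣ qf b c y0 - L := by
      have : (p:ℤ)^(2*s+1) ∣ qf b c y0 - qf b c x := by
        unfold qf
        rw [← Finset.sum_sub_distrib]
        apply Finset.dvd_sum
        intro t _
        have : b t * y0 t^2 + c t * y0 t - (b t * x t^2 + c t * x t) = (y0 t - x t) * (b t * (y0 t + x t) + c t) := by ring
        rw [this]
        exact Dvd.dvd.mul_right (hy0 t) _
      have := dvd_add this h2
      rwa [sub_add_sub_cancel] at this
    obtain ⟨a, -, ha⟩ := hensel_quad p hp (b i) (c i) (x i)
      (L - ∑ t ∈ Finset.univ.erase i, (b t * y0 t^2 + c t * y0 t)) s h1 (by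
        rw [hsplit, hy0i] at hq
        convert hq using 1; ring) k
    refine ⟨Function.update y0 i a, ?_, ?_⟩
    · rintro ⟨j, hj⟩
      simp [hj, y0]
    · rw [hsplit]
      have : ∑ t ∈ Finset.univ.erase i, (b t * Function.update y0 i a t^2 + c t * Function.update y0 i a t)
        = ∑ t ∈ Finset.univ.erase i, (b t * y0 t^2 + c t * y0 t) := by
        apply Finset.sum_congr rfl
        intro t ht
        rw [Function.update_of_ne (Finset.ne_of_mem_erase ht)]
      rw [this]
      simp only [Function.update_self]
      convert ha using 1; ring
  choose y hy1 hy2 using hex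
  unfold rho
  refine Nat.card_le_card_of_injective (fun w : X => (⟨fun j => ((y w j : ℤ) : ZMod (p^k)), ?_⟩ :
    {x : Fin 5 → ZMod (p^k) // ∑ i, ((b i : ZMod (p^k)) * x i^2 + (c i : ZMod (p^k)) * x i) = (L : ZMod (p^k))})) ?_
  · have := hy2 w
    have h3 : (((qf b c (y w) - L : ℤ)) : ZMod (p^k)) = 0 := by
      rw [ZMod.intCast_zmod_eq_zero_iff_dvd]; exact_mod_cast this
    unfold qf at h3
    push_cast at h3
    rw [sub_eq_zero] at h3
    exact h3
  · intro w w' hww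
    simp only [Subtype.mk.injEq] at hww
    ext j
    have h3 := congrFun hww j
    rw [hy1, hy1, ZMod.intCast_eq_intCast_iff_dvd_sub] at h3
    have h4 : (p:ℤ)^(2*s+1) * p^(k-(2*s+1)) ∣ (p:ℤ)^(2*s+1) * (((w' j : ℕ):ℤ) - (w j : ℕ)) ∨ k < 2*s+1 := by
      by_cases hk : k < 2*s+1
      · exact Or.inr hk
      · left
        rw [← pow_add]
        have e : 2*s+1+(k-(2*s+1)) = k := by omega
        rw [e]
        convert h3 using 1
        · push_cast; rfl
        · ring
    rcases h4 with h4 | h4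
    · have h5 := (mul_dvd_mul_iff_left (pow_ne_zero _ hpp.ne_zero)).mp h4
      have l1 := (w j).2
      have l2 := (w' j).2
      have h6 := Int.emod_emod_of_dvd
      have h7 : ((w j : ℕ) : ℤ) ≡ (w' j : ℕ) [ZMOD ((p^(k-(2*s+1)) : ℕ) : ℤ)] := by
        rw [Int.modEq_iff_dvd]; push_cast; exact h5
      have h8 := (Int.natCast_modEq_iff).mp h7
      exact Nat.ModEq.eq_of_lt_of_lt h8 l1 l2
    · have e : k - (2*s+1) = 0 := by omega
      have l1 := (w j).2
      have l2 := (w' j).2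
      simp only [e, pow_zero] at l1 l2
      omega

lemma rho_prime (p : ℕ) (hp : p.Prime) (b c : Fin 5 → ℤ) (hb : ∀ i, b i ≠ 0) :
    ∃ (e : ℕ) (σ : ℝ), 0 < σ ∧ ∀ L : ℤ, (∃ x, (p:ℤ)^e ∣ qf b c x - L) → ∀ k,
      σ * ((p^k : ℕ) : ℝ)^4 ≤ rho b c L (p^k) := by
  obtain ⟨e, he⟩ := local_sol p hp b c hb
  have hp0 : (0:ℝ) < p := by exact_mod_cast hp.pos
  have hp1 : (1:ℝ) ≤ p := by exact_mod_cast hp.one_lt.le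
  refine ⟨e, ((p:ℝ)^(2*e+1))⁻¹^4, by positivity, fun L hL k => ?_⟩
  obtain ⟨x, i, s, hs, h1, h2⟩ := he L hL
  have := rho_pow p hp b c L x i s h1 h2 k
  have h3 : (((p^(k-(2*s+1)))^4 : ℕ) : ℝ) ≤ rho b c L (p^k) := by exact_mod_cast this
  refine le_trans ?_ h3
  push_cast
  rw [← mul_pow]
  gcongr
  rw [inv_mul_le_iff₀ (by positivity), ← pow_add]
  exact pow_le_pow_right₀ hp1 (by omega)
end

section
lemma tail_small (ε : ℝ) (hε : 0 < ε) : ∃ w : ℕ, ∀ t : Finset ℕ, (∀ q ∈ t, w < q) →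
    ∑ q ∈ t, (q:ℝ)^(-(3/2):ℝ) < ε := by
  have hs : Summable (fun q : ℕ => (q:ℝ)^(-(3/2):ℝ)) := Real.summable_nat_rpow.mpr (by norm_num)
  obtain ⟨s, hs⟩ := summable_iff_vanishing_norm.mp hs ε hε
  refine ⟨s.sup id, fun t ht => lt_of_le_of_lt (le_abs_self _) (hs t ?_)⟩
  rw [Finset.disjoint_left]
  intro q hq hqs
  have := ht q hq
  have h2 : q ≤ s.sup id := Finset.le_sup (f := id) hqs
  omega

noncomputable def gs (V : ℕ) [NeZero V] (b c : ℤ) (k : ZMod V) : ℂ :=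
  ∑ x : ZMod V, ZMod.stdAddChar (N := V) (k * (b * x^2 + c * x))

lemma annih_card (V : ℕ) [NeZero V] (k : ZMod V) :
    Nat.card {h : ZMod V // k * h = 0} * addOrderOf k = V := by
  have h1 := AddSubgroup.card_mul_index (AddMonoidHom.mulLeft k).ker
  rw [AddSubgroup.index_ker] at h1
  have h2 : (AddMonoidHom.mulLeft k).range = AddSubgroup.zmultiples k := by
    ext y
    constructor
    · rintro ⟨h, rfl⟩
      refine ⟨(h.val : ℤ), ?_⟩
      simp [mul_comm]
    · rintro ⟨n, rfl⟩
      exact ⟨(n : ZMod V), by simp [mul_comm]⟩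
  rw [h2, Nat.card_zmultiples, Nat.card_zmod] at h1
  exact h1

lemma gs_sq (V : ℕ) [NeZero V] (b c : ℤ) (hb : IsUnit ((2 * b : ℤ) : ZMod V)) (k : ZMod V) :
    ‖gs V b c k‖^2 ≤ V * Nat.card {h : ZMod V // k * h = 0} := by
  classical
  have hprim := ZMod.isPrimitive_stdAddChar V
  have h1 : (gs V b c k) * (starRingEnd ℂ) (gs V b c k) =
      ∑ h : ZMod V, ZMod.stdAddChar (N := V) (k * (b * h^2 + c * h)) * (if 2 * b * (k * h) = 0 then (V:ℂ) else 0) := by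
    unfold gs
    rw [map_sum, Finset.sum_mul_sum, Finset.sum_comm]
    calc _ = ∑ y : ZMod V, ∑ h : ZMod V, (ZMod.stdAddChar (N := V) (k * (b * (h+y)^2 + c * (h+y))) : ℂ) *
          (starRingEnd ℂ) (ZMod.stdAddChar (N := V) (k * (b * y^2 + c * y))) := by
            apply Finset.sum_congr rfl
            intro y _
            exact (Equiv.sum_comp (Equiv.addRight y) (fun x => (ZMod.stdAddChar (N := V) (k * (b * x^2 + c * x)) : ℂ) *
          (starRingEnd ℂ) (ZMod.stdAddChar (N := V) (k * (b * y^2 + c * y))))).symm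
      _ = ∑ y : ZMod V, ∑ h : ZMod V, (ZMod.stdAddChar (N := V) (k * (b * h^2 + c * h)) : ℂ) * ZMod.stdAddChar (N := V) (y * (2 * b * (k * h))) := by
            apply Finset.sum_congr rfl
            intro y _
            apply Finset.sum_congr rfl
            intro h _
            rw [← AddChar.map_neg_eq_conj, ← AddChar.map_add_eq_mul, ← AddChar.map_add_eq_mul]
            congr 1
            ring
      _ = _ := by
            rw [Finset.sum_comm]
            apply Finset.sum_congr rfl
            intro h _
            rw [← Finset.mul_sum, AddChar.sum_mulShift _ hprim]
            congr 1
            rw [ZMod.card]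
            push_cast
            rfl
  rw [RCLike.mul_conj] at h1
  have h2 : ‖gs V b c k‖^2 = ‖(((‖gs V b c k‖:ℝ):ℂ))^2‖ := by simp
  rw [h2]
  erw [h1]
  refine (norm_sum_le _ _).trans ?_
  have h3 : ∀ h : ZMod V, ‖(ZMod.stdAddChar (N := V) (k * (b * h^2 + c * h)) : ℂ) * (if 2 * b * (k * h) = 0 then (V:ℂ) else 0)‖
    = if k * h = 0 then (V:ℝ) else 0 := by
    intro h
    rw [norm_mul, AddChar.norm_apply, one_mul]
    push_cast at hb
    have : (2 * (b : ZMod V) * (k*h) = 0) ↔ k * h = 0 := hb.mul_right_eq_zero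
    simp only [this]
    split_ifs <;> simp
  simp_rw [h3]
  rw [← Finset.sum_filter, Finset.sum_const, nsmul_eq_mul, Nat.card_eq_fintype_card, Fintype.card_subtype, mul_comm]

lemma gs_bound (V : ℕ) [NeZero V] (b c : ℤ) (hb : IsUnit ((2 * b : ℤ) : ZMod V)) (k : ZMod V) :
    ‖gs V b c k‖ ≤ V * (addOrderOf k : ℝ)^(-(1/2):ℝ) := by
  have h1 := gs_sq V b c hb k
  have h2 := annih_card V k
  have h3 : 0 < addOrderOf k := addOrderOf_pos k
  have h3' : (0:ℝ) < addOrderOf k := by exact_mod_cast h3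
  have h4 : ((Nat.card {h : ZMod V // k * h = 0} : ℕ) : ℝ) = V * (addOrderOf k : ℝ)⁻¹ := by
    rw [eq_mul_inv_iff_mul_eq₀ h3'.ne']; exact_mod_cast h2
  rw [h4] at h1
  apply le_of_sq_le_sq₀ _ (by positivity)
  refine h1.trans (le_of_eq ?_)
  rw [mul_pow, ← Real.rpow_natCast, ← Real.rpow_natCast, ← Real.rpow_mul h3'.le]
  norm_num
  rw [Real.rpow_neg_one]
  ring
where
  le_of_sq_le_sq₀ {a b : ℝ} (h : a^2 ≤ b^2) (hb : 0 ≤ b) : a ≤ b := by nlinarith [abs_le_of_sq_le_sq' h hb]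

lemma rho_fourier (V : ℕ) [NeZero V] (b c : Fin 5 → ℤ) (L : ℤ) :
    (V:ℂ) * rho b c L V = ∑ k : ZMod V, ZMod.stdAddChar (N := V) (-(k * L)) * ∏ i, gs V (b i) (c i) k := by
  classical
  have hprim := ZMod.isPrimitive_stdAddChar V
  have hprod : ∀ k : ZMod V, ∏ i, gs V (b i) (c i) k =
      ∑ x : Fin 5 → ZMod V, ZMod.stdAddChar (N := V) (k * ∑ i, (b i * x i^2 + c i * x i)) := by
    intro k
    unfold gs
    rw [Finset.prod_univ_sum]
    simp only [Fintype.piFinset_univ]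
    apply Finset.sum_congr rfl
    intro x _
    rw [Finset.mul_sum]
    simp only [Fin.prod_univ_five, Fin.sum_univ_five, AddChar.map_add_eq_mul]
  simp_rw [hprod, Finset.mul_sum]
  rw [Finset.sum_comm]
  have h2 : ∀ x : Fin 5 → ZMod V, ∑ k : ZMod V, (ZMod.stdAddChar (N := V) (-(k * L)) : ℂ) * ZMod.stdAddChar (N := V) (∑ i, k * (b i * x i^2 + c i * x i))
    = if (∑ i, ((b i : ZMod V) * x i^2 + (c i : ZMod V) * x i) = (L : ZMod V)) then (V:ℂ) else 0 := by
    intro x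
    have := AddChar.sum_mulShift (ψ := (ZMod.stdAddChar : AddChar (ZMod V) ℂ)) (∑ i, ((b i : ZMod V) * x i^2 + (c i : ZMod V) * x i) - L) hprim
    rw [ZMod.card] at this
    simp_rw [← AddChar.map_add_eq_mul, ← Finset.mul_sum]
    simp_rw [sub_eq_zero] at this
    push_cast at this
    rw [← this]
    apply Finset.sum_congr rfl
    intro k _
    congr 1; ring
  simp_rw [h2]
  rw [← Finset.sum_filter, Finset.sum_const, nsmul_eq_mul, mul_comm]
  unfold rho
  rw [Nat.card_eq_fintype_card, Fintype.card_subtype]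

lemma rho_rough (V : ℕ) (hV : 0 < V) (b c : Fin 5 → ℤ) (L : ℤ) (w : ℕ)
    (hw : ∀ t : Finset ℕ, (∀ q ∈ t, w < q) → ∑ q ∈ t, (q:ℝ)^(-(3/2):ℝ) < 1/2)
    (hVw : ∀ q, q ∣ V → q ≠ 1 → w < q) (hb : ∀ i, IsUnit ((2 * b i : ℤ) : ZMod V)) :
    (1/2) * (V:ℝ)^4 ≤ rho b c L V := by
  classical
  have : NeZero V := ⟨hV.ne'⟩
  have hV' : (0:ℝ) < V := by exact_mod_cast hV
  have h := rho_fourier V b c L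
  rw [← Finset.add_sum_erase _ _ (Finset.mem_univ (0 : ZMod V))] at h
  have h0 : (ZMod.stdAddChar (N := V) (-((0:ZMod V) * L)) : ℂ) * ∏ i, gs V (b i) (c i) 0 = (V:ℂ)^5 := by
    simp [gs, ZMod.card]
  rw [h0] at h
  have hE : ‖∑ k ∈ Finset.univ.erase (0 : ZMod V), (ZMod.stdAddChar (N := V) (-(k * L)) : ℂ) * ∏ i, gs V (b i) (c i) k‖
      ≤ (V:ℝ)^5 * (1/2) := by
    refine (norm_sum_le _ _).trans ?_
    calc _ ≤ ∑ k ∈ Finset.univ.erase (0 : ZMod V), (V:ℝ)^5 * (addOrderOf k : ℝ)^(-(5/2):ℝ) := by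
          apply Finset.sum_le_sum
          intro k _
          rw [norm_mul, AddChar.norm_apply, one_mul, norm_prod]
          calc _ ≤ ∏ i : Fin 5, (V * (addOrderOf k : ℝ)^(-(1/2):ℝ)) :=
                Finset.prod_le_prod (fun _ _ => norm_nonneg _) (fun i _ => gs_bound V (b i) (c i) (hb i) k)
            _ = _ := by
                rw [Finset.prod_const, mul_pow, ← Real.rpow_natCast (_ ^ (_:ℝ)), ← Real.rpow_mul (by positivity)]
                norm_num
      _ ≤ _ := by
          rw [← Finset.mul_sum]
          gcongr
          refine le_trans ?_ (hw (V.divisors.erase 1) ?_).le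
          · rw [← Finset.sum_fiberwise_of_maps_to (t := V.divisors.erase 1) (g := fun k : ZMod V => addOrderOf k)]
            · apply Finset.sum_le_sum
              intro q hq
              have hq' := Finset.mem_erase.mp hq
              have hqV := Nat.dvd_of_mem_divisors hq'.2
              have hq0 : 0 < q := Nat.pos_of_dvd_of_pos hqV hV
              have hq0' : (0:ℝ) < q := by exact_mod_cast hq0
              have hc : (Finset.univ.filter (fun k : ZMod V => addOrderOf k = q)).card ≤ q := by
                rw [IsAddCyclic.card_addOrderOf_eq_totient (by rwa [ZMod.card])]
                exact Nat.totient_le q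
              calc _ = ∑ k ∈ (Finset.univ.erase (0 : ZMod V)).filter (fun k => addOrderOf k = q), (q:ℝ)^(-(5/2):ℝ) := by
                    apply Finset.sum_congr rfl
                    intro k hk
                    rw [(Finset.mem_filter.mp hk).2]
                _ ≤ q * (q:ℝ)^(-(5/2):ℝ) := by
                    rw [Finset.sum_const, nsmul_eq_mul]
                    gcongr
                    exact (Finset.card_le_card (Finset.filter_subset_filter _ (Finset.erase_subset _ _))).trans hc
                _ = _ := by
                    nth_rw 1 [← Real.rpow_one (q:ℝ)]
                    rw [← Real.rpow_add hq0']; norm_num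
            · intro k hk
              rw [Finset.mem_erase, Nat.mem_divisors]
              refine ⟨?_, ?_, hV.ne'⟩
              · rw [Ne, AddMonoid.addOrderOf_eq_one_iff]; exact (Finset.mem_erase.mp hk).1
              · have := addOrderOf_dvd_card (x := k)
                rwa [ZMod.card] at this
          · intro q hq
            have hq' := Finset.mem_erase.mp hq
            exact hVw q (Nat.dvd_of_mem_divisors hq'.2) hq'.1
  have h5 : ‖(V:ℂ) * rho b c L V - (V:ℂ)^5‖ ≤ (V:ℝ)^5 * (1/2) := by
    rw [h, add_sub_cancel_left]; exact hE
  have h6 : (V:ℂ) * rho b c L V - (V:ℂ)^5 = (((V:ℝ) * rho b c L V - (V:ℝ)^5 : ℝ) : ℂ) := by push_cast; ring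
  rw [h6, Complex.norm_real, Real.norm_eq_abs] at h5
  have h7 := (abs_le.mp h5).1
  have h8 : (V:ℝ) * ((1/2) * (V:ℝ)^4) ≤ V * rho b c L V := by nlinarith
  exact le_of_mul_le_mul_left h8 hV'

lemma rho_lower (b c : Fin 5 → ℤ) (hb : ∀ i, b i ≠ 0) :
    ∃ (M : ℕ) (σ : ℝ), 0 < M ∧ 0 < σ ∧ ∀ L : ℤ, (∃ x, (M:ℤ) ∣ qf b c x - L) → ∀ W : ℕ, 0 < W →
      σ * (W:ℝ)^4 ≤ rho b c L W := by
  classical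
  obtain ⟨w, hw⟩ := tail_small (1/2) (by norm_num)
  set P1 := w + ∑ i, (2 * b i).natAbs + 1 with hP1
  have hloc : ∀ p : ℕ, ∃ (e : ℕ) (σ : ℝ), 0 < σ ∧ (p.Prime → ∀ L : ℤ, (∃ x, (p:ℤ)^e ∣ qf b c x - L) → ∀ k,
      σ * ((p^k : ℕ) : ℝ)^4 ≤ rho b c L (p^k)) := by
    intro p
    by_cases hp : p.Prime
    · obtain ⟨e, σ, h1, h2⟩ := rho_prime p hp b c hb
      exact ⟨e, σ, h1, fun _ => h2⟩
    · exact ⟨0, 1, one_pos, fun h => absurd h hp⟩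
  choose e σ hσ hloc using hloc
  set S := (Finset.range (P1+1)).filter Nat.Prime with hS
  refine ⟨∏ p ∈ S, p^(e p), (∏ p ∈ S, σ p) * (1/2), ?_, ?_, ?_⟩
  · exact Finset.prod_pos fun p hp => pow_pos (Finset.mem_filter.mp hp).2.pos _
  · exact mul_pos (Finset.prod_pos fun p _ => hσ p) (by norm_num)
  intro L ⟨x, hx⟩ W hW
  have hx' : ∀ p ∈ S, (p:ℤ)^(e p) ∣ qf b c x - L := by
    intro p hp
    refine Dvd.dvd.trans ?_ hx
    have := Finset.dvd_prod_of_mem (fun p => p^(e p)) hp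
    exact_mod_cast this
  have hdec : ∀ S' ⊆ S, ∃ U V : ℕ, 0 < U ∧ 0 < V ∧ W = U * V ∧ Nat.Coprime U V ∧ (∀ p ∈ S', ¬ p ∣ V) ∧
      (∏ p ∈ S', σ p) * (U:ℝ)^4 ≤ rho b c L U := by
    intro S'
    induction S' using Finset.induction_on with
    | empty =>
      intro _
      refine ⟨1, W, one_pos, hW, by simp, by simp, by simp, ?_⟩
      simp only [Finset.prod_empty, Nat.cast_one, one_pow, mul_one]
      have : 0 < rho b c L 1 := by
        unfold rho
        have : Nonempty {x : Fin 5 → ZMod 1 // ∑ i, ((b i : ZMod 1) * x i^2 + (c i : ZMod 1) * x i) = (L : ZMod 1)} :=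
          ⟨⟨fun _ => 0, Subsingleton.elim _ _⟩⟩
        exact Nat.card_pos
      exact_mod_cast this
    | insert p S' hp ih =>
      intro hsub
      obtain ⟨U, V, hU, hV, hUV, hcop, hnd, hle⟩ := ih (fun q hq => hsub (Finset.mem_insert_of_mem hq))
      have hpS : p ∈ S := hsub (Finset.mem_insert_self _ _)
      have hpp : p.Prime := (Finset.mem_filter.mp hpS).2
      obtain ⟨k, V', hV', hVV⟩ := Nat.exists_eq_pow_mul_and_not_dvd hV.ne' p hpp.ne_one
      have hV'0 : 0 < V' := by
        rcases Nat.eq_zero_or_pos V' with h | h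
        · subst h; simp at hV'
        · exact h
      have hcop1 : Nat.Coprime U (p^k) := Nat.Coprime.coprime_dvd_right (by rw [hVV]; exact dvd_mul_right _ _) hcop
      have hcop2 : Nat.Coprime U V' := Nat.Coprime.coprime_dvd_right (by rw [hVV]; exact dvd_mul_left _ _) hcop
      refine ⟨U * p^k, V', Nat.mul_pos hU (pow_pos hpp.pos _), hV'0, by rw [hUV, hVV]; ring, ?_, ?_, ?_⟩
      · exact Nat.Coprime.mul_left hcop2 (Nat.Coprime.pow_left _ ((Nat.Prime.coprime_iff_not_dvd hpp).mpr hV'))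
      · intro q hq
        rcases Finset.mem_insert.mp hq with rfl | hq
        · exact hV'
        · intro h
          exact hnd q hq (by rw [hVV]; exact Dvd.dvd.mul_left h _)
      · rw [rho_mul _ _ _ _ _ hcop1, Finset.prod_insert hp]
        have h1 := hloc p hpp L ⟨x, hx' p hpS⟩ k
        have := mul_le_mul h1 hle (by have := Finset.prod_pos (s := S') fun p _ => hσ p; positivity) (by positivity)
        push_cast at this ⊢
        nlinarith
  obtain ⟨U, V, hU, hV, hUV, hcop, hnd, hle⟩ := hdec S subset_rfl
  have hbig : ∀ q, q ∣ V → q ≠ 1 → P1 < q := by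
    intro q hq hq1
    by_contra hlt
    push Not at hlt
    have hmf := Nat.minFac_prime hq1
    apply hnd q.minFac _ ((Nat.minFac_dvd q).trans hq)
    rw [hS, Finset.mem_filter, Finset.mem_range]
    have hq0 : 0 < q := Nat.pos_of_dvd_of_pos hq hV
    have := Nat.minFac_le hq0
    exact ⟨by omega, hmf⟩
  have hV2 := rho_rough V hV b c L w hw (fun q hq hq1 => by have := hbig q hq hq1; omega) (by
    intro i
    rw [ZMod.coe_int_isUnit_iff_isCoprime, Int.isCoprime_iff_gcd_eq_one, Int.gcd_comm]
    by_contra hne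
    change Nat.gcd (2 * b i).natAbs V ≠ 1 at hne
    have h1 := hbig (Nat.gcd (2 * b i).natAbs V) (Nat.gcd_dvd_right _ _) hne
    have h2 : Nat.gcd (2 * b i).natAbs V ≤ (2 * b i).natAbs := Nat.gcd_le_left _ (by
      have := hb i; omega)
    have h3 : (2 * b i).natAbs ≤ ∑ i, (2 * b i).natAbs :=
      Finset.single_le_sum (f := fun i => (2 * b i).natAbs) (fun _ _ => Nat.zero_le _) (Finset.mem_univ i)
    omega)
  rw [hUV, rho_mul _ _ _ _ _ hcop]
  have := mul_le_mul hle hV2 (by positivity) (by positivity)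
  push_cast
  nlinarith
end

section
/-- e(θ) -/
noncomputable def ee (θ : ℝ) : ℂ := Complex.exp ((2 * Real.pi * θ : ℝ) * Complex.I)

lemma ee_add (x y : ℝ) : ee (x+y) = ee x * ee y := by
  unfold ee; rw [← Complex.exp_add]; congr 1; push_cast; ring

lemma ee_norm (x : ℝ) : ‖ee x‖ = 1 := Complex.norm_exp_ofReal_mul_I _

lemma ee_zero : ee 0 = 1 := by simp [ee]

lemma ee_int (n : ℤ) : ee n = 1 := by
  unfold ee
  rw [Complex.exp_eq_one_iff]
  exact ⟨n, by push_cast; ring⟩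

lemma ee_conj (x : ℝ) : (starRingEnd ℂ) (ee x) = ee (-x) := by
  unfold ee
  rw [← Complex.exp_conj]
  congr 1
  rw [map_mul, Complex.conj_ofReal, Complex.conj_I]; push_cast; ring

lemma ee_add_int (x : ℝ) (n : ℤ) : ee (x + n) = ee x := by rw [ee_add, ee_int, mul_one]

lemma ee_sub_one_le (x : ℝ) : ‖ee x - 1‖ ≤ 2 * Real.pi * |x| := by
  unfold ee
  have := Real.norm_exp_I_mul_ofReal_sub_one_le (x := 2 * Real.pi * x)
  rw [mul_comm]
  refine this.trans (le_of_eq ?_)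
  rw [Real.norm_eq_abs, abs_mul, abs_of_pos (by positivity)]

lemma ee_cont : Continuous ee := by unfold ee; fun_prop

/-- distance to the nearest integer -/
noncomputable def nd (θ : ℝ) : ℝ := |θ - round θ|

lemma nd_nonneg (θ : ℝ) : 0 ≤ nd θ := abs_nonneg _
lemma nd_le_abs (θ : ℝ) (n : ℤ) : nd θ ≤ |θ - n| := round_le θ n
lemma nd_le_half (θ : ℝ) : nd θ ≤ 1/2 := abs_sub_round θ

lemma nd_add_le (x y : ℝ) : nd (x + y) ≤ nd x + |y| := by
  refine (nd_le_abs _ (round x)).trans ?_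
  unfold nd
  have : x + y - round x = (x - round x) + y := by ring
  rw [this]; exact abs_add_le _ _

lemma nd_neg (x : ℝ) : nd (-x) = nd x := by
  apply le_antisymm
  · refine (nd_le_abs _ (-round x)).trans (le_of_eq ?_)
    unfold nd; rw [← abs_neg]; congr 1; push_cast; ring
  · refine (nd_le_abs _ (-round (-x))).trans (le_of_eq ?_)
    unfold nd; rw [← abs_neg]; congr 1; push_cast; ring

lemma nd_le_ee (θ : ℝ) : 2 * nd θ ≤ ‖ee θ - 1‖ := by
  have h1 : ee θ = ee (θ - round θ) := by
    rw [← ee_add_int (θ - round θ) (round θ)]; congr 1; ring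
  rw [h1]
  unfold nd
  have h2 := abs_sub_round θ
  set t := θ - round θ
  unfold ee
  rw [mul_comm ((2 * Real.pi * t : ℝ) : ℂ) Complex.I, Complex.norm_exp_I_mul_ofReal_sub_one, Real.norm_eq_abs, abs_mul]
  have h3 : 2 * Real.pi * t / 2 = Real.pi * t := by ring
  rw [h3]
  have h4 : 2 / Real.pi * |Real.pi * t| ≤ |Real.sin (Real.pi * t)| := by
    apply Real.mul_abs_le_abs_sin
    rw [abs_mul, abs_of_pos Real.pi_pos]
    nlinarith [Real.pi_pos]
  rw [abs_mul, abs_of_pos Real.pi_pos] at h4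
  have h5 : 2 / Real.pi * (Real.pi * |t|) = 2 * |t| := by
    field_simp
  rw [h5] at h4
  rw [abs_of_pos (by norm_num : (0:ℝ) < 2)]
  nlinarith [abs_nonneg t]

lemma geom_tel (θ : ℝ) (s : ℤ) (n : ℕ) :
    (ee θ - 1) * ∑ y ∈ Finset.Ico s (s+n), ee (θ * y) = ee (θ * ((s+n : ℤ) : ℝ)) - ee (θ * s) := by
  induction n with
  | zero => simp
  | succ n ih =>
    have : Finset.Ico s (s + ((n+1 : ℕ) : ℤ)) = insert (s+n) (Finset.Ico s (s+n)) := by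
      ext y; simp only [Finset.mem_Ico, Finset.mem_insert]; push_cast; omega
    rw [this, Finset.sum_insert (by simp), mul_add, ih]
    have h : ee (θ * ((s + ((n+1:ℕ):ℤ) : ℤ) : ℝ)) = ee θ * ee (θ * ((s+n : ℤ):ℝ)) := by
      rw [← ee_add]; congr 1; push_cast; ring
    rw [h]; ring

noncomputable def mn (B : ℝ) (θ : ℝ) : ℝ := B / max 1 (B * nd θ)

lemma mn_nonneg (B θ : ℝ) (hB : 0 ≤ B) : 0 ≤ mn B θ := by
  unfold mn; positivity

lemma mn_le (B θ : ℝ) (hB : 0 ≤ B) : mn B θ ≤ B := by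
  unfold mn; exact div_le_self hB (le_max_left _ _)

lemma mn_neg (B θ : ℝ) : mn B (-θ) = mn B θ := by unfold mn; rw [nd_neg]

lemma geom_bound (θ : ℝ) (s t : ℤ) (B : ℝ) (h : (t - s : ℤ) ≤ B) (hB : 0 ≤ B) :
    ‖∑ y ∈ Finset.Ico s t, ee (θ * y)‖ ≤ mn B θ := by
  rcases le_or_gt s t with hst | hst
  · obtain ⟨n, rfl⟩ : ∃ n : ℕ, t = s + n := ⟨(t-s).toNat, by omega⟩
    unfold mn
    rw [le_div_iff₀ (by positivity)]
    set Z := ∑ y ∈ Finset.Ico s (s+n), ee (θ * y)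
    have h1 : ‖Z‖ ≤ B := by
      refine (norm_sum_le _ _).trans ?_
      simp only [ee_norm, Finset.sum_const, Int.card_Ico, nsmul_eq_mul, mul_one]
      refine le_trans ?_ h
      simp
    have h2 : ‖Z‖ * nd θ ≤ 1 := by
      have h3 := congrArg norm (geom_tel θ s n)
      rw [norm_mul] at h3
      have h4 : ‖ee (θ * ((s+n : ℤ) : ℝ)) - ee (θ * s)‖ ≤ 2 := by
        refine (norm_sub_le _ _).trans ?_
        rw [ee_norm, ee_norm]; norm_num
      have h5 := nd_le_ee θ
      have h6 := norm_nonneg Z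
      nlinarith
    rw [mul_max_of_nonneg _ _ (norm_nonneg _)]
    refine max_le (by simpa using h1) ?_
    nlinarith [norm_nonneg Z, nd_nonneg θ]
  · rw [Finset.Ico_eq_empty (by omega)]
    simpa using mn_nonneg B θ hB

/-- the exponential sum -/
noncomputable def SS (B : ℕ) (b c : ℤ) (α : ℝ) : ℂ :=
  ∑ x ∈ Finset.Ico (0:ℤ) B, ee (α * (b * x^2 + c * x : ℤ))

lemma weyl (B : ℕ) (b c : ℤ) (α : ℝ) :
    ‖SS B b c α‖^2 ≤ ∑ h ∈ Finset.Ioo (-(B:ℤ)) B, mn B (α * (2 * b * h : ℤ)) := by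
  have h1 : SS B b c α * (starRingEnd ℂ) (SS B b c α) =
      ∑ h ∈ Finset.Ioo (-(B:ℤ)) B, ee (α * (b*h^2 + c * h : ℤ)) *
        ∑ y ∈ Finset.Ico (max 0 (-h)) (min B (B-h)), ee (α * (2 * b * h : ℤ) * y) := by
    unfold SS
    rw [map_sum, Finset.sum_mul_sum, Finset.sum_comm]
    simp_rw [ee_conj, Finset.mul_sum]
    rw [Finset.sum_sigma', Finset.sum_sigma']
    refine Finset.sum_nbij' (fun p => ⟨p.2 - p.1, p.1⟩) (fun p => ⟨p.2, p.2 + p.1⟩) ?_ ?_ ?_ ?_ ?_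
    · rintro ⟨y, x⟩ h
      simp only [Finset.mem_sigma, Finset.mem_Ico, Finset.mem_Ioo] at h ⊢
      omega
    · rintro ⟨h, y⟩ hh
      simp only [Finset.mem_sigma, Finset.mem_Ico, Finset.mem_Ioo] at hh ⊢
      omega
    · rintro ⟨y, x⟩ h
      simp
    · rintro ⟨h, y⟩ hh
      simp
    · rintro ⟨y, x⟩ h
      simp only
      rw [← ee_add, ← ee_add]
      congr 1
      push_cast; ring
  rw [RCLike.mul_conj] at h1
  have h2 : ‖SS B b c α‖^2 = ‖(((‖SS B b c α‖:ℝ):ℂ))^2‖ := by simp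
  rw [h2]
  erw [h1]
  refine (norm_sum_le _ _).trans ?_
  apply Finset.sum_le_sum
  intro h hh
  rw [norm_mul, ee_norm, one_mul]
  apply geom_bound
  · have : min (B:ℤ) (B - h) - max 0 (-h) ≤ B := by omega
    exact_mod_cast this
  · positivity

noncomputable def FF (H B : ℕ) (α : ℝ) : ℝ := B + 2 * ∑ l ∈ Finset.Icc 1 H, mn B (α * l)

lemma weyl' (B A : ℕ) (b c : ℤ) (hb : 0 < b) (hA : 2 * b ≤ A) (α : ℝ) :
    ‖SS B b c α‖^2 ≤ FF (A*B) B α := by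
  refine (weyl B b c α).trans ?_
  have hB : (0:ℝ) ≤ B := by positivity
  rcases Nat.eq_zero_or_pos B with h0 | hB0
  · subst h0; simp [FF]
  have hsplit : Finset.Ioo (-(B:ℤ)) B = insert 0 ((Finset.Icc 1 (B-1)).image (fun n : ℕ => (n:ℤ)) ∪ (Finset.Icc 1 (B-1)).image (fun n : ℕ => -(n:ℤ))) := by
    ext h
    simp only [Finset.mem_Ioo, Finset.mem_insert, Finset.mem_union, Finset.mem_image, Finset.mem_Icc]
    constructor
    · intro hh
      rcases lt_trichotomy h 0 with h1 | h1 | h1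
      · right; right; exact ⟨h.natAbs, by omega, by omega⟩
      · left; exact h1
      · right; left; exact ⟨h.natAbs, by omega, by omega⟩
    · rintro (h | ⟨n, hn, rfl⟩ | ⟨n, hn, rfl⟩) <;> omega
  have hsub : ∑ n ∈ Finset.Icc 1 (B-1), mn B (α * (2 * b * (n:ℤ) : ℤ)) ≤ ∑ l ∈ Finset.Icc 1 (A*B), mn B (α * l) := by
    obtain ⟨d, rfl⟩ : ∃ d : ℕ, b = d := ⟨b.toNat, by omega⟩
    have hd : 0 < d := by omega
    have hA' : 2 * d ≤ A := by omega
    have : ∑ n ∈ Finset.Icc 1 (B-1), mn B (α * (2 * (d:ℤ) * (n:ℤ) : ℤ)) = ∑ l ∈ (Finset.Icc 1 (B-1)).image (fun n => 2*d*n), mn B (α * l) := by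
      rw [Finset.sum_image]
      · apply Finset.sum_congr rfl
        intro n _
        push_cast; rfl
      · intro x _ y _ hxy
        have : 2 * d ≠ 0 := by omega
        exact Nat.eq_of_mul_eq_mul_left (by omega) hxy
    rw [this]
    apply Finset.sum_le_sum_of_subset_of_nonneg
    · intro l hl
      simp only [Finset.mem_image, Finset.mem_Icc] at hl ⊢
      obtain ⟨n, hn, rfl⟩ := hl
      constructor
      · have : 0 < 2 * d * n := Nat.mul_pos (by omega) (by omega)
        omega
      · exact Nat.mul_le_mul hA' (by omega)
    · intro l _ _; exact mn_nonneg _ _ hB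
  rw [hsplit, Finset.sum_insert, Finset.sum_union, Finset.sum_image, Finset.sum_image]
  · have h3 : ∑ n ∈ Finset.Icc 1 (B-1), mn B (α * (2 * b * (-(n:ℤ)) : ℤ)) = ∑ n ∈ Finset.Icc 1 (B-1), mn B (α * (2 * b * (n:ℤ) : ℤ)) := by
      apply Finset.sum_congr rfl
      intro n _
      rw [← mn_neg]; congr 1; push_cast; ring
    rw [h3]
    unfold FF
    have := mn_le B (α * ((2 * b * 0 : ℤ) : ℝ)) hB
    linarith
  · intro x _ y _ h; simpa using h
  · intro x _ y _ h; simpa using h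
  · rw [Finset.disjoint_left]
    intro h h1 h2
    simp only [Finset.mem_image, Finset.mem_Icc] at h1 h2
    obtain ⟨n, hn, rfl⟩ := h1
    obtain ⟨m, hm, h⟩ := h2
    omega
  · simp only [Finset.mem_union, Finset.mem_image, Finset.mem_Icc]
    rintro (⟨n, hn, h⟩ | ⟨n, hn, h⟩) <;> omega
end

section
lemma sum_inv_sqrt (D : ℕ) : ∑ k ∈ Finset.Icc 1 D, 1 / √(k:ℝ) ≤ 2 * √(D:ℝ) := by
  induction D with
  | zero => simp
  | succ n ih =>
    rw [Finset.sum_Icc_succ_top (by omega)]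
    have h1 : (0:ℝ) < √((n+1:ℕ):ℝ) := by positivity
    have h2 : √(n:ℝ) ^2 = n := Real.sq_sqrt (by positivity)
    have h3 : √((n+1:ℕ):ℝ) ^2 = n+1 := by rw [Real.sq_sqrt (by positivity)]; push_cast; rfl
    have h4 : 1 / √((n+1:ℕ):ℝ) ≤ 2 * √((n+1:ℕ):ℝ) - 2 * √(n:ℝ) := by
      rw [div_le_iff₀ h1]
      nlinarith [sq_nonneg (√((n+1:ℕ):ℝ) - √(n:ℝ))]
    linarith

lemma nd_eq_abs (x : ℝ) (hx : |x| ≤ 1/2) : |x| ≤ nd x := by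
  unfold nd
  by_cases h : round x = 0
  · rw [h]; simp
  · have h1 : (1:ℝ) ≤ |(round x : ℝ)| := by
      exact_mod_cast Int.one_le_abs h
    have h2 : |(round x : ℝ)| ≤ |x - round x| + |x| := by
      have := abs_sub_abs_le_abs_sub (round x : ℝ) x
      rw [abs_sub_comm] at this
      linarith
    linarith

lemma nd_add_int (x : ℝ) (n : ℤ) : nd (x + n) = nd x := by
  unfold nd; rw [round_add_intCast]; push_cast; congr 1; ring

lemma mn_le_inv (B θ d : ℝ) (hB : 0 < B) (hd : 0 < d) (h : d ≤ nd θ) : mn B θ ≤ 1 / d := by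
  unfold mn
  rw [div_le_div_iff₀ (by positivity) hd]
  have : B * nd θ ≤ max 1 (B * nd θ) := le_max_right _ _
  nlinarith

/-- multiples of q -/
lemma part_div (A B q : ℕ) (hA : 0 < A) (hB : 0 < B) (hq : 0 < q) (a : ℤ) (β α : ℝ)
    (hα : α = a / q + β) (hβ : |β| * q * (2 * (A * B)) ≤ 1) :
    ∑ l ∈ Finset.Icc 1 (A*B) with q ∣ l, mn B (α * l) ≤ 3 * A * (B^2 / (q * √(1 + B^2*|β|))) := by
  have hAr : (0:ℝ) < A := by exact_mod_cast hA
  have hBr : (0:ℝ) < B := by exact_mod_cast hB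
  have hqr : (0:ℝ) < q := by exact_mod_cast hq
  have hset : (Finset.Icc 1 (A*B)).filter (q ∣ ·) = (Finset.Icc 1 (A*B/q)).image (fun k => q * k) := by
    ext l
    simp only [Finset.mem_filter, Finset.mem_Icc, Finset.mem_image]
    constructor
    · rintro ⟨⟨h1, h2⟩, k, rfl⟩
      refine ⟨k, ⟨Nat.pos_of_mul_pos_left (a := q) (by omega) , ?_⟩, rfl⟩
      rw [Nat.le_div_iff_mul_le hq]; linarith
    · rintro ⟨k, ⟨h1, h2⟩, rfl⟩
      rw [Nat.le_div_iff_mul_le hq] at h2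
      exact ⟨⟨Nat.mul_pos hq h1, by linarith⟩, dvd_mul_right _ _⟩
  rw [hset, Finset.sum_image (by intro x _ y _ h; exact Nat.eq_of_mul_eq_mul_left hq h)]
  set D := A*B/q with hD
  have hDq : (D:ℝ) * q ≤ A * B := by
    have : D * q ≤ A * B := Nat.div_mul_le_self _ _
    exact_mod_cast this
  set T : ℝ := B^2*|β| with hT
  have hT0 : 0 ≤ T := by positivity
  set E : ℝ := 2 * A * B / (q * (1+T)) with hE
  have hE0 : 0 < E := by positivity
  have key : ∀ k ∈ Finset.Icc 1 D, mn B (α * ((q*k : ℕ):ℝ)) ≤ B * √E * (1 / √(k:ℝ)) := by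
    intro k hk
    rw [Finset.mem_Icc] at hk
    have hk0 : (1:ℝ) ≤ k := by exact_mod_cast hk.1
    have hkD : (k:ℝ) ≤ D := by exact_mod_cast hk.2
    have hqk : (k:ℝ) * q ≤ A * B := le_trans (by gcongr) hDq
    have e1 : α * ((q*k : ℕ):ℝ) = β * (q*k) + ((a*k : ℤ):ℝ) := by
      rw [hα]; push_cast; field_simp; ring
    have habs : |β * (q*k)| = |β| * q * k := by
      rw [abs_mul, abs_of_nonneg (by positivity : (0:ℝ) ≤ q * k)]; ring
    have hn : |β| * q * k ≤ nd (α * ((q*k : ℕ):ℝ)) := by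
      rw [e1, nd_add_int, ← habs]
      apply nd_eq_abs
      rw [habs]
      have h1 : (k:ℝ) ≤ A * B := by
        have : (1:ℝ) ≤ q := by exact_mod_cast hq
        nlinarith
      have h2 : 0 ≤ |β| * q := by positivity
      nlinarith
    unfold mn
    set y := max 1 (B * nd (α * ((q*k : ℕ):ℝ))) with hy
    have hy1 : 1 ≤ y := le_max_left _ _
    have hy2 : B * (|β| * q * k) ≤ y := le_trans (by gcongr) (le_max_right _ _)
    have h3 : k / E ≤ y := by
      have : k / E = k * (q * (1+T)) / (2 * A * B) := by rw [hE]; field_simp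
      rw [this, div_le_iff₀ (by positivity)]
      have h4 : k * q * T = B * (B * (|β| * q * k)) := by rw [hT]; ring
      have h5 : B * (B * (|β| * q * k)) ≤ A * B * y := by
        have : (1:ℝ) ≤ A := by exact_mod_cast hA
        calc B * (B * (|β| * q * k)) ≤ B * y := by gcongr
          _ ≤ A * B * y := by
            have : 0 ≤ B * y := by positivity
            nlinarith
      have h6 : k * q ≤ A * B * y := by
        have : (0:ℝ) < A * B := by positivity
        nlinarith
      nlinarith
    have h4 : √(k/E) ≤ y := by
      rw [Real.sqrt_le_left (by linarith)]
      nlinarith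
    have h5 : 0 < √(k/E) := by positivity
    calc B / y ≤ B / √(k/E) := by gcongr
      _ = B * √E * (1 / √(k:ℝ)) := by
        rw [Real.sqrt_div (by positivity)]
        field_simp
  calc _ ≤ ∑ k ∈ Finset.Icc 1 D, B * √E * (1 / √(k:ℝ)) := Finset.sum_le_sum key
    _ = B * √E * ∑ k ∈ Finset.Icc 1 D, (1 / √(k:ℝ)) := by rw [Finset.mul_sum]
    _ ≤ B * √E * (2 * √(D:ℝ)) := by gcongr; exact sum_inv_sqrt D
    _ = 2 * B * √(E * D) := by rw [Real.sqrt_mul hE0.le]; ring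
    _ ≤ 2 * B * √(2 * (A * B / q)^2 / (1+T)) := by
        gcongr
        rw [hE]
        have : (D:ℝ) ≤ A * B / q := by rw [le_div_iff₀ hqr]; exact hDq
        calc 2 * A * B / (q * (1+T)) * D ≤ 2 * A * B / (q * (1+T)) * (A * B / q) := by gcongr
          _ = _ := by field_simp
    _ = 2 * B * (√2 * (A * B / q) / √(1+T)) := by
        rw [Real.sqrt_div (by positivity), Real.sqrt_mul (by norm_num), Real.sqrt_sq (by positivity)]
    _ ≤ 2 * B * ((3/2) * (A * B / q) / √(1+T)) := by
        gcongr
        rw [Real.sqrt_le_left (by norm_num)]; norm_num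
    _ = _ := by
      have : 0 < √(1+T) := by positivity
      field_simp

lemma part_ndiv (A B q : ℕ) (hA : 0 < A) (hB : 0 < B) (hq : 0 < q) (a : ℤ) (β α : ℝ)
    (hco : IsCoprime a (q:ℤ)) (hq2 : q ≤ 2 * (A * B))
    (hα : α = a / q + β) (hβ : |β| * q * (2 * (A * B)) ≤ 1) :
    ∑ l ∈ Finset.Icc 1 (A*B) with ¬ q ∣ l, mn B (α * l) ≤ 12 * A * (B * (1 + Real.log (2 * A * B))) := by
  have hAr : (0:ℝ) < A := by exact_mod_cast hA
  have hBr : (0:ℝ) < B := by exact_mod_cast hB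
  have hqr : (0:ℝ) < q := by exact_mod_cast hq
  set g : ℕ → ℝ := fun r => 2 * (q * (1 / (r:ℝ)) + q * (1 / ((q - r : ℕ):ℝ))) with hg
  have hg0 : ∀ r, 0 ≤ g r := by intro r; rw [hg]; positivity
  set R : ℕ → ℕ := fun l => ((a * l) % (q:ℤ)).toNat with hR
  have hRc : ∀ l, ((R l : ℕ) : ℤ) = (a * l) % (q:ℤ) := fun l => Int.toNat_of_nonneg (Int.emod_nonneg _ (by omega))
  have hRlt : ∀ l, R l < q := by
    intro l
    have := Int.emod_lt_of_pos (a * l) (by omega : (0:ℤ) < q)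
    rw [← hRc] at this; omega
  have hRpos : ∀ l, ¬ q ∣ l → 0 < R l := by
    intro l hl
    rw [Nat.pos_iff_ne_zero]
    intro h0
    apply hl
    have h1 : (q:ℤ) ∣ a * l := by
      apply Int.dvd_of_emod_eq_zero; rw [← hRc, h0]; rfl
    have := hco.symm.dvd_of_dvd_mul_left h1
    exact_mod_cast this
  have key : ∀ l ∈ (Finset.Icc 1 (A*B)).filter (¬ q ∣ ·), mn B (α * l) ≤ g (R l) := by
    intro l hl
    simp only [Finset.mem_filter, Finset.mem_Icc] at hl
    have hr0 := hRpos l hl.2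
    have hrq := hRlt l
    have hl1 : (l:ℝ) ≤ A * B := by exact_mod_cast hl.1.2
    set r := R l with hr
    have hr0' : (0:ℝ) < r := by exact_mod_cast hr0
    have hqr' : (((q - r : ℕ)):ℝ) = q - r := by rw [Nat.cast_sub hrq.le]
    have hqrp : (0:ℝ) < q - r := by rw [← hqr']; exact_mod_cast (by omega : 0 < q - r)
    -- lower bound for nd (r/q)
    have e1 : (a:ℝ) * l / q = (r:ℝ)/q + ((a * l / (q:ℤ) : ℤ) : ℝ) := by
      have := Int.emod_add_mul_ediv (a*l) q
      rw [← hRc, ← hr] at this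
      have h2 : (a:ℝ) * l = r + q * ((a * l / (q:ℤ) : ℤ) : ℝ) := by exact_mod_cast this.symm
      rw [h2]; field_simp
    set s : ℝ := 1 / (q * (1 / (r:ℝ)) + q * (1 / ((q - r : ℕ):ℝ))) with hs
    have hs0 : 0 < s := by rw [hs, hqr']; positivity
    have hsval : s = r * (q - r) / q^2 := by
      rw [hs, hqr']; field_simp; ring
    have hnd : s ≤ nd ((r:ℝ)/q) := by
      unfold nd
      set z := round ((r:ℝ)/q)
      have hz : s ≤ |(r:ℝ)/q - z| := by
        rcases le_or_gt z 0 with hz | hz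
        · have : (z:ℝ) ≤ 0 := by exact_mod_cast hz
          refine le_trans ?_ (le_abs_self _)
          have h1 : s ≤ r / q := by
            rw [hsval, div_le_div_iff₀ (by positivity) hqr]
            nlinarith [mul_pos hr0' hqr, mul_pos hr0' hr0']
          linarith
        · have : (1:ℝ) ≤ z := by exact_mod_cast hz
          refine le_trans ?_ (neg_le_abs _)
          have h1 : s ≤ 1 - r / q := by
            have : 1 - (r:ℝ)/q = (q - r)/q := by field_simp
            rw [this, hsval, div_le_div_iff₀ (by positivity) hqr]
            nlinarith [mul_pos hqrp hqr, mul_pos hqrp hqrp]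
          linarith
      exact hz
    have hnd2 : 1 / q ≤ nd ((r:ℝ)/q) := by
      unfold nd
      set z := round ((r:ℝ)/q)
      have : (r:ℝ)/q - z = ((r - q * z : ℤ):ℝ) / q := by push_cast; field_simp
      rw [this, abs_div, abs_of_pos hqr]
      gcongr
      have : (r:ℤ) - q * z ≠ 0 := by
        intro h
        have h2 : (q:ℤ) ∣ r := ⟨z, by linarith⟩
        have := Nat.le_of_dvd hr0 (by exact_mod_cast h2)
        omega
      exact_mod_cast Int.one_le_abs this
    have hb : |β * l| ≤ 1 / (2*q) := by
      rw [abs_mul, abs_of_nonneg (by positivity : (0:ℝ) ≤ l), le_div_iff₀ (by positivity)]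
      have : 0 ≤ |β| * q := by positivity
      nlinarith
    have h6 : nd ((r:ℝ)/q) ≤ nd (α * l) + |β * l| := by
      have e2 : (a:ℝ) * l / q = α * l + (-(β * l)) := by rw [hα]; ring
      have := nd_add_le (α * l) (-(β*l))
      rw [← e2, e1, nd_add_int, abs_neg] at this
      exact this
    have h7 : s / 2 ≤ nd (α * l) := by
      have : 1/(2*(q:ℝ)) = (1/q)/2 := by field_simp
      linarith
    refine (mn_le_inv B _ (s/2) hBr (by positivity) h7).trans (le_of_eq ?_)
    rw [hs, hg]; simp
  have hharm : ∑ r ∈ Finset.Icc 1 (q-1), (1 / (r:ℝ)) ≤ 1 + Real.log (2 * A * B) := by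
    have h1 := harmonic_le_one_add_log (q-1)
    have h2 : ((harmonic (q-1) : ℚ) : ℝ) = ∑ r ∈ Finset.Icc 1 (q-1), (1 / (r:ℝ)) := by
      rw [harmonic_eq_sum_Icc]; push_cast; simp
    rw [h2] at h1
    refine h1.trans ?_
    have h3 : (1:ℝ) ≤ 2 * A * B := by
      have : 1 ≤ 2 * A * B := Nat.mul_pos (by omega) hB
      exact_mod_cast this
    rcases Nat.eq_zero_or_pos (q-1) with h | h
    · rw [h]; simp; exact Real.log_nonneg h3
    · gcongr
      have : q - 1 ≤ 2 * A * B := by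
        have : 2 * A * B = 2 * (A * B) := by ring
        omega
      exact_mod_cast this
  have hgsum : ∑ r ∈ Finset.Icc 1 (q-1), g r ≤ 4 * q * (1 + Real.log (2 * A * B)) := by
    have hrefl : ∑ r ∈ Finset.Icc 1 (q-1), (1 / ((q - r : ℕ):ℝ)) = ∑ r ∈ Finset.Icc 1 (q-1), (1 / (r:ℝ)) := by
      refine Finset.sum_nbij' (fun r => q - r) (fun r => q - r) ?_ ?_ ?_ ?_ ?_
      · intro r hr; simp only [Finset.mem_Icc] at hr ⊢; omega
      · intro r hr; simp only [Finset.mem_Icc] at hr ⊢; omega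
      · intro r hr; simp only [Finset.mem_Icc] at hr ⊢; omega
      · intro r hr; simp only [Finset.mem_Icc] at hr ⊢; omega
      · intro r hr; rfl
    rw [hg, ← Finset.mul_sum, Finset.sum_add_distrib, ← Finset.mul_sum, ← Finset.mul_sum, hrefl]
    nlinarith
  calc ∑ l ∈ Finset.Icc 1 (A*B) with ¬ q ∣ l, mn B (α * l)
      ≤ ∑ l ∈ Finset.Icc 1 (A*B) with ¬ q ∣ l, g (R l) := Finset.sum_le_sum key
    _ = ∑ p ∈ ((Finset.Icc 1 (A*B)).filter (¬ q ∣ ·)).image (fun l => (l / q, R l)), g p.2 := by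
        rw [Finset.sum_image]
        intro x hx y hy h
        simp only [Prod.mk.injEq] at h
        obtain ⟨h1, h2⟩ := h
        have h3 : (a * x) % (q:ℤ) = (a * y) % (q:ℤ) := by rw [← hRc, ← hRc, h2]
        have h4 : (q:ℤ) ∣ a * (x - y) := by
          rw [mul_sub]; exact Int.dvd_of_emod_eq_zero (Int.emod_eq_emod_iff_emod_sub_eq_zero.mp h3)
        have h5 : (q:ℤ) ∣ (x:ℤ) - y := hco.symm.dvd_of_dvd_mul_left h4
        have h6 : x % q = y % q := by
          have := (Int.emod_emod_of_dvd (x:ℤ) (dvd_refl (q:ℤ)))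
          have h7 : (x:ℤ) % q = (y:ℤ) % q := Int.emod_eq_emod_iff_emod_sub_eq_zero.mpr (Int.emod_eq_zero_of_dvd h5)
          exact_mod_cast h7
        rw [← Nat.div_add_mod x q, ← Nat.div_add_mod y q, h1, h6]
    _ ≤ ∑ p ∈ Finset.range (A*B/q+1) ×ˢ Finset.Icc 1 (q-1), g p.2 := by
        apply Finset.sum_le_sum_of_subset_of_nonneg
        · intro p hp
          simp only [Finset.mem_image, Finset.mem_filter, Finset.mem_Icc] at hp
          obtain ⟨l, ⟨hl, hl2⟩, rfl⟩ := hp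
          simp only [Finset.mem_product, Finset.mem_range, Finset.mem_Icc]
          refine ⟨?_, hRpos l hl2, ?_⟩
          · have := Nat.div_le_div_right (c := q) hl.2
            omega
          · have := hRlt l; omega
        · intro p _ _; exact hg0 _
    _ = ((A*B/q+1 : ℕ):ℝ) * ∑ r ∈ Finset.Icc 1 (q-1), g r := by
        rw [Finset.sum_product]; simp
    _ ≤ ((A*B/q+1 : ℕ):ℝ) * (4 * q * (1 + Real.log (2 * A * B))) := by gcongr
    _ = 4 * (((A*B/q+1 : ℕ):ℝ) * q) * (1 + Real.log (2 * A * B)) := by ring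
    _ ≤ 4 * (3 * (A * B)) * (1 + Real.log (2 * A * B)) := by
        have h1 : (A*B/q+1) * q ≤ 3 * (A * B) := by
          rw [add_mul]
          have := Nat.div_mul_le_self (A*B) q
          omega
        have h3 : (1:ℝ) ≤ 2 * A * B := by
          have : 1 ≤ 2 * A * B := Nat.mul_pos (by omega) hB
          exact_mod_cast this
        have := Real.log_nonneg h3
        have h1' : ((A*B/q+1 : ℕ):ℝ) * q ≤ 3 * (A * B) := by exact_mod_cast h1
        exact mul_le_mul_of_nonneg_right (mul_le_mul_of_nonneg_left h1' (by norm_num)) (by linarith)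
    _ = _ := by ring

lemma ff_bound (A B q : ℕ) (hA : 0 < A) (hB : 0 < B) (hq : 0 < q) (a : ℤ) (β α : ℝ)
    (hco : IsCoprime a (q:ℤ)) (hq2 : q ≤ 2 * (A * B))
    (hα : α = a / q + β) (hβ : |β| * q * (2 * (A * B)) ≤ 1) :
    FF (A*B) B α ≤ 25 * A * (B^2 / (q * √(1 + B^2*|β|)) + B * (1 + Real.log (2 * A * B))) := by
  unfold FF
  rw [← Finset.sum_filter_add_sum_filter_not (Finset.Icc 1 (A*B)) (q ∣ ·)]
  have h1 := part_div A B q hA hB hq a β α hα hβ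
  have h2 := part_ndiv A B q hA hB hq a β α hco hq2 hα hβ
  have h3 : (1:ℝ) ≤ 2 * A * B := by
    have : 1 ≤ 2 * A * B := Nat.mul_pos (by omega) hB
    exact_mod_cast this
  have h4 := Real.log_nonneg h3
  have hAr : (1:ℝ) ≤ A := by exact_mod_cast hA
  have hBr : (0:ℝ) < B := by exact_mod_cast hB
  have hqr : (0:ℝ) < q := by exact_mod_cast hq
  have h5 : (B:ℝ) ≤ A * (B * (1 + Real.log (2 * A * B))) := by
    have : (B:ℝ) ≤ B * (1 + Real.log (2 * A * B)) := by nlinarith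
    have : 0 ≤ (B * (1 + Real.log (2 * A * B))) := by positivity
    nlinarith
  have h6 : 0 ≤ A * (B^2 / (q * √(1 + B^2*|β|))) := by positivity
  nlinarith
end

section
open MeasureTheory

lemma int_ee (k : ℤ) : ∫ α in (0:ℝ)..1, ee (α * k) = if k = 0 then 1 else 0 := by
  split_ifs with h
  · subst h; simp [ee_zero]
  · have hc : (2 * Real.pi * k : ℂ) * Complex.I ≠ 0 := by
      have : (k:ℂ) ≠ 0 := by exact_mod_cast h
      have := Complex.ofReal_ne_zero.mpr Real.pi_ne_zero
      simp_all
    have h1 : ∀ α : ℝ, ee (α * k) = Complex.exp ((2 * Real.pi * k : ℂ) * Complex.I * α) := by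
      intro α; unfold ee; congr 1; push_cast; ring
    simp_rw [h1]
    rw [integral_exp_mul_complex hc]
    have h2 := ee_int k
    unfold ee at h2
    have h3 : Complex.exp ((2 * Real.pi * k : ℂ) * Complex.I * (1:ℝ)) = 1 := by
      rw [← h2]; congr 1; push_cast; ring
    rw [h3]; simp

/-- number of representations in the box -/
noncomputable def rr (b c : Fin 5 → ℤ) (B : ℕ) (k : ℤ) : ℕ :=
  ((Fintype.piFinset (fun _ : Fin 5 => Finset.Ico (0:ℤ) B)).filter (fun x => qf b c x = k)).card

noncomputable def KK (W J : ℕ) (α : ℝ) : ℂ := (1 / (J:ℂ)) * ∑ j ∈ Finset.range J, ee (α * ((W * j : ℕ) : ℤ))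

lemma ee_sum (s : Finset (Fin 5)) (f : Fin 5 → ℝ) : ee (∑ i ∈ s, f i) = ∏ i ∈ s, ee (f i) := by
  classical
  induction s using Finset.induction_on with
  | empty => simp [ee_zero]
  | insert a s ha ih => rw [Finset.sum_insert ha, Finset.prod_insert ha, ee_add, ih]

lemma prod_SS (b c : Fin 5 → ℤ) (B : ℕ) (α : ℝ) :
    ∏ i, SS B (b i) (c i) α = ∑ x ∈ Fintype.piFinset (fun _ : Fin 5 => Finset.Ico (0:ℤ) B), ee (α * qf b c x) := by
  unfold SS
  rw [Finset.prod_univ_sum]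
  apply Finset.sum_congr rfl
  intro x _
  rw [← ee_sum]
  congr 1
  unfold qf
  push_cast
  rw [Finset.mul_sum]

lemma int_prod (b c : Fin 5 → ℤ) (B : ℕ) (k : ℤ) :
    ∫ α in (0:ℝ)..1, (∏ i, SS B (b i) (c i) α) * ee (-(α * k)) = rr b c B k := by
  simp_rw [prod_SS, Finset.sum_mul, ← ee_add]
  rw [intervalIntegral.integral_finsetSum]
  · have : ∀ x : Fin 5 → ℤ, ∀ α : ℝ, α * qf b c x + -(α * k) = α * ((qf b c x - k : ℤ) : ℝ) := by
      intro x α; push_cast; ring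
    simp_rw [this, int_ee]
    rw [← Finset.sum_filter]
    unfold rr
    simp [sub_eq_zero]
  · intro x _
    apply Continuous.intervalIntegrable
    exact ee_cont.comp (by fun_prop)

lemma SS_cont (B : ℕ) (b c : ℤ) : Continuous (SS B b c) := by
  unfold SS
  refine continuous_finsetSum _ (fun x _ => ee_cont.comp (by fun_prop))

lemma KK_cont (W J : ℕ) : Continuous (KK W J) := by
  unfold KK
  refine continuous_const.mul (continuous_finsetSum _ (fun x _ => ee_cont.comp (by fun_prop)))

lemma int_main (b c : Fin 5 → ℤ) (B W J : ℕ) (L : ℤ) :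
    ∫ α in (0:ℝ)..1, (∏ i, SS B (b i) (c i) α) * ee (-(α * L)) * (1 - KK W J α) =
      (((rr b c B L : ℝ) - (1 / (J:ℝ)) * ∑ j ∈ Finset.range J, (rr b c B (L - W * j) : ℝ) : ℝ) : ℂ) := by
  have h1 : ∀ α : ℝ, (∏ i, SS B (b i) (c i) α) * ee (-(α * L)) * (1 - KK W J α) =
      (∏ i, SS B (b i) (c i) α) * ee (-(α * L)) -
       (1 / (J:ℂ)) * ∑ j ∈ Finset.range J, (∏ i, SS B (b i) (c i) α) * ee (-(α * ((L - W * j : ℤ) : ℝ))) := by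
    intro α
    rw [mul_sub, mul_one]
    congr 1
    unfold KK
    rw [mul_left_comm, Finset.mul_sum]
    congr 1
    apply Finset.sum_congr rfl
    intro j _
    rw [mul_assoc, ← ee_add]
    congr 2
    push_cast; ring
  simp_rw [h1]
  have hc : ∀ k : ℤ, Continuous (fun α : ℝ => (∏ i, SS B (b i) (c i) α) * ee (-(α * k))) := by
    intro k
    exact (continuous_finsetProd _ (fun i _ => SS_cont _ _ _)).mul (ee_cont.comp (by fun_prop))
  rw [intervalIntegral.integral_sub, intervalIntegral.integral_const_mul, intervalIntegral.integral_finsetSum]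
  · simp_rw [int_prod]
    push_cast; rfl
  · intro j _; exact (hc _).intervalIntegrable _ _
  · exact (hc _).intervalIntegrable _ _
  · exact (continuous_const.mul (continuous_finsetSum _ (fun j _ => hc _))).intervalIntegrable _ _

lemma KK_two (W J : ℕ) (hJ : 0 < J) (α : ℝ) : ‖1 - KK W J α‖ ≤ 2 := by
  refine (norm_sub_le _ _).trans ?_
  have : ‖KK W J α‖ ≤ 1 := by
    unfold KK
    rw [norm_mul]
    have h1 : ‖∑ j ∈ Finset.range J, ee (α * ((W * j : ℕ) : ℤ))‖ ≤ J := by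
      refine (norm_sum_le _ _).trans ?_
      simp [ee_norm]
    have h2 : (0:ℝ) < J := by exact_mod_cast hJ
    simp only [one_div, norm_inv, Complex.norm_natCast]
    rw [inv_mul_le_iff₀ h2]; linarith
  simp; linarith

lemma KK_small (W J q : ℕ) (hJ : 0 < J) (hq : 0 < q) (hqW : q ∣ W) (a : ℤ) (α β : ℝ) (hα : α = a / q + β) :
    ‖1 - KK W J α‖ ≤ 2 * Real.pi * W * J * |β| := by
  have h2 : (0:ℝ) < J := by exact_mod_cast hJ
  have hJc : (J:ℂ) ≠ 0 := by exact_mod_cast hJ.ne'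
  have hqr : (q:ℝ) ≠ 0 := by exact_mod_cast hq.ne'
  have h3 : 1 - KK W J α = (1 / (J:ℂ)) * ∑ j ∈ Finset.range J, (1 - ee (α * ((W * j : ℕ) : ℤ))) := by
    unfold KK
    rw [Finset.sum_sub_distrib, mul_sub]
    simp [hJc]
  rw [h3, norm_mul]
  have h1 : ‖∑ j ∈ Finset.range J, (1 - ee (α * ((W * j : ℕ) : ℤ)))‖ ≤ ∑ j ∈ Finset.range J, 2 * Real.pi * W * J * |β| := by
    refine (norm_sum_le _ _).trans (Finset.sum_le_sum ?_)
    intro j hj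
    obtain ⟨v, hv⟩ := hqW
    have e1 : α * (((W * j : ℕ) : ℤ) : ℝ) = β * (W * j) + ((a * v * j : ℤ) : ℝ) := by
      rw [hα, hv]; push_cast; field_simp; ring
    rw [e1, ee_add_int, norm_sub_rev]
    refine (ee_sub_one_le _).trans ?_
    rw [abs_mul, abs_of_nonneg (by positivity : (0:ℝ) ≤ W * j)]
    have : (j:ℝ) ≤ J := by exact_mod_cast (Finset.mem_range.mp hj).le
    have h5 : 2 * Real.pi * W * j * |β| ≤ 2 * Real.pi * W * J * |β| := by gcongr
    calc _ = 2 * Real.pi * W * j * |β| := by ring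
      _ ≤ _ := h5
  rw [Finset.sum_const, Finset.card_range, nsmul_eq_mul] at h1
  simp only [one_div, norm_inv, Complex.norm_natCast]
  rw [inv_mul_le_iff₀ h2]; exact h1
end

section
open MeasureTheory

noncomputable def EL (A B : ℕ) : ℝ := B * (1 + Real.log (2 * A * B))

lemma EL_nonneg (A B : ℕ) (hA : 0 < A) (hB : 0 < B) : 0 ≤ EL A B := by
  have h3 : (1:ℝ) ≤ 2 * A * B := by
    have : 1 ≤ 2 * A * B := Nat.mul_pos (by omega) hB
    exact_mod_cast this
  have := Real.log_nonneg h3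
  unfold EL; positivity

noncomputable def C2 (A : ℕ) : ℝ := 16 * √(25 * A)^5

lemma prod_bound (b c : Fin 5 → ℤ) (A B q : ℕ) (hb : ∀ i, 0 < b i) (hbA : ∀ i, 2 * b i ≤ A)
    (hA : 0 < A) (hB : 0 < B) (hq : 0 < q) (a : ℤ) (β α : ℝ)
    (hco : IsCoprime a (q:ℤ)) (hq2 : q ≤ 2 * (A * B))
    (hα : α = a / q + β) (hβ : |β| * q * (2 * (A * B)) ≤ 1) :
    ‖∏ i, SS B (b i) (c i) α‖ ≤ C2 A * ((B:ℝ)^5 * (q:ℝ)^(-(5/2):ℝ) * (1 + B^2*|β|)^(-(5/4):ℝ) + √(EL A B)^5) := by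
  have hff := ff_bound A B q hA hB hq a β α hco hq2 hα hβ
  have hY := EL_nonneg A B hA hB
  change FF (A*B) B α ≤ 25 * A * (B^2 / (q * √(1 + B^2*|β|)) + EL A B) at hff
  have hBr : (0:ℝ) < B := by exact_mod_cast hB
  have hqr : (0:ℝ) < q := by exact_mod_cast hq
  set Y := EL A B
  set U : ℝ := 1 + B^2*|β| with hU
  have hU0 : 0 < U := by positivity
  set X : ℝ := B^2 / (q * √U) with hX
  have hX0 : 0 ≤ X := by positivity
  have h1 : ∀ i, ‖SS B (b i) (c i) α‖ ≤ √(25 * A * (X + Y)) := by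
    intro i
    apply Real.le_sqrt_of_sq_le
    exact (weyl' B A (b i) (c i) (hb i) (hbA i) α).trans hff
  have h2 : √(X+Y) ≤ √X + √Y := by
    rw [Real.sqrt_le_left (by positivity)]
    nlinarith [Real.sq_sqrt hX0, Real.sq_sqrt hY, mul_nonneg (Real.sqrt_nonneg X) (Real.sqrt_nonneg Y)]
  have h3 : √X^5 = (B:ℝ)^5 * (q:ℝ)^(-(5/2):ℝ) * U^(-(5/4):ℝ) := by
    have e1 : √X = B * (q:ℝ)^(-(1/2):ℝ) * U^(-(1/4):ℝ) := by
      rw [hX, Real.sqrt_div (by positivity), Real.sqrt_sq hBr.le, Real.sqrt_mul hqr.le, Real.sqrt_eq_rpow, Real.sqrt_eq_rpow, Real.sqrt_eq_rpow, ← Real.rpow_mul hU0.le, Real.rpow_neg hqr.le, Real.rpow_neg hU0.le]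
      norm_num
      field_simp
    rw [e1, mul_pow, mul_pow, ← Real.rpow_mul_natCast hqr.le, ← Real.rpow_mul_natCast hU0.le]
    norm_num
  calc ‖∏ i, SS B (b i) (c i) α‖ = ∏ i, ‖SS B (b i) (c i) α‖ := norm_prod _ _
    _ ≤ ∏ i : Fin 5, √(25 * A * (X + Y)) := Finset.prod_le_prod (fun _ _ => norm_nonneg _) (fun i _ => h1 i)
    _ = √(25*A)^5 * √(X+Y)^5 := by
        rw [Finset.prod_const, Real.sqrt_mul (by positivity), mul_pow]; simp
    _ ≤ √(25*A)^5 * (√X + √Y)^5 := by gcongr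
    _ ≤ √(25*A)^5 * (2^(5-1) * (√X^5 + √Y^5)) := by
        gcongr; exact add_pow_le (by positivity) (by positivity) 5
    _ = _ := by rw [h3]; unfold C2; norm_num; ring

lemma min_rpow (y z : ℝ) (hy : 0 ≤ y) (h1 : z ≤ 2) (h2 : z ≤ y) : z ≤ 2 * y^((1/8):ℝ) := by
  rcases le_or_gt 1 y with h | h
  · have := Real.one_le_rpow h (by norm_num : (0:ℝ) ≤ 1/8)
    linarith
  · have h3 : y ≤ y^((1/8):ℝ) := by
      have := Real.rpow_le_rpow_of_exponent_ge' hy h.le (by norm_num : (0:ℝ) ≤ 1/8) (by norm_num : (1/8:ℝ) ≤ 1)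
      simpa using this
    have : 0 ≤ y^((1/8):ℝ) := by positivity
    linarith

noncomputable def omg (W : ℕ) (δ : ℝ) (q : ℕ) : ℝ := if q ∣ W then δ^((1/8):ℝ) else 1

noncomputable def phi (t : ℝ) : ℝ := (1 + ‖t‖)^(-(9/8):ℝ)

lemma phi_nonneg (t : ℝ) : 0 ≤ phi t := by unfold phi; positivity

lemma pt_bound (b c : Fin 5 → ℤ) (A B W J : ℕ) (hb : ∀ i, 0 < b i) (hbA : ∀ i, 2 * b i ≤ A)
    (hA : 0 < A) (hB : 0 < B) (hJ : 0 < J) (α : ℝ) (h0 : 0 ≤ α) (h1 : α ≤ 1) (L : ℤ) :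
    ‖(∏ i, SS B (b i) (c i) α) * ee (-(α * L)) * (1 - KK W J α)‖ ≤
     2 * C2 A * ((∑ q ∈ Finset.Icc 1 (2 * (A * B)), ∑ a ∈ Finset.range (q+1),
        omg W (2 * Real.pi * W * J / B^2) q * (B^5 * (q:ℝ)^(-(5/2):ℝ)) * phi (B^2 * (α - a / q))) + √(EL A B)^5) := by
  have hBr : (0:ℝ) < B := by exact_mod_cast hB
  set δ : ℝ := 2 * Real.pi * W * J / B^2 with hδ
  have hδ0 : 0 ≤ δ := by positivity
  have hom : ∀ q, 0 ≤ omg W δ q := by intro q; unfold omg; split_ifs <;> positivity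
  have hC2 : 0 ≤ C2 A := by unfold C2; positivity
  obtain ⟨x, hx1, hx2⟩ := Real.exists_rat_abs_sub_le_and_den_le α (n := 2 * (A * B)) (by positivity)
  set q := x.den with hq
  have hq0 : 0 < q := x.den_pos
  have hqr : (1:ℝ) ≤ q := by exact_mod_cast hq0
  have hH : (1:ℝ) ≤ 2 * (A * B) := by
    have : 1 ≤ 2 * (A * B) := Nat.mul_pos (by omega) (Nat.mul_pos hA hB)
    exact_mod_cast this
  have hxe : (x:ℝ) = (x.num : ℝ) / q := by rw [hq]; exact Rat.cast_def x
  set β := α - x with hβ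
  have hαe : α = (x.num : ℝ) / q + β := by rw [hβ, hxe]; ring
  have hβ1 : |β| * ((2 * (A * B) + 1) * q) ≤ 1 := by
    rw [le_div_iff₀ (by positivity)] at hx1
    push_cast at hx1; exact hx1
  have hβ2 : |β| * q * (2 * (A * B)) ≤ 1 := by
    have : 0 ≤ |β| * q := by positivity
    nlinarith
  have hβ3 : |β| * q < 1 := by
    have h0 : 0 ≤ |β| * q := by positivity
    nlinarith
  have hnum : α * q = x.num + β * q := by rw [hαe]; field_simp
  have hbq : |β * q| < 1 := by rw [abs_mul, abs_of_pos (by linarith : (0:ℝ) < q)]; exact hβ3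
  rw [abs_lt] at hbq
  have ha0 : 0 ≤ x.num := by
    have : (-1:ℝ) < x.num := by nlinarith
    have : (-1:ℤ) < x.num := by exact_mod_cast this
    omega
  have ha1 : x.num ≤ q := by
    have : (x.num:ℝ) < q + 1 := by nlinarith
    have : x.num < q + 1 := by exact_mod_cast this
    omega
  obtain ⟨a, ha⟩ : ∃ a : ℕ, x.num = a := ⟨x.num.toNat, by omega⟩
  have hco : IsCoprime x.num (q:ℤ) := by
    rw [Int.isCoprime_iff_gcd_eq_one]
    exact x.reduced
  have hprod := prod_bound b c A B q hb hbA hA hB hq0 x.num β α hco hx2 hαe hβ2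
  have hphi : phi (B^2 * (α - a / q)) = (1 + B^2 * |β|)^(-(9/8):ℝ) := by
    unfold phi
    have : α - a / q = β := by rw [hβ, hxe, ha]; push_cast; rfl
    rw [this, norm_mul, Real.norm_eq_abs, Real.norm_eq_abs, abs_of_nonneg (by positivity : (0:ℝ) ≤ B^2)]
  set U : ℝ := 1 + B^2*|β| with hU
  have hU1 : 1 ≤ U := by have : 0 ≤ B^2*|β| := by positivity
                         linarith
  have hU0 : 0 < U := by linarith
  have hterm : omg W δ q * (B^5 * (q:ℝ)^(-(5/2):ℝ)) * phi (B^2 * (α - a / q)) ≤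
      ∑ q ∈ Finset.Icc 1 (2 * (A * B)), ∑ a ∈ Finset.range (q+1),
        omg W δ q * (B^5 * (q:ℝ)^(-(5/2):ℝ)) * phi (B^2 * (α - a / q)) := by
    have hnn : ∀ q a : ℕ, 0 ≤ omg W δ q * (B^5 * (q:ℝ)^(-(5/2):ℝ)) * phi (B^2 * (α - a / q)) := by
      intro q a
      have := hom q; have := phi_nonneg (B^2 * (α - a / q)); positivity
    refine le_trans ?_ (Finset.single_le_sum (f := fun q : ℕ => ∑ a ∈ Finset.range (q+1),
        omg W δ q * (B^5 * (q:ℝ)^(-(5/2):ℝ)) * phi (B^2 * (α - a / q))) (fun q _ => Finset.sum_nonneg (fun a _ => hnn q a)) (Finset.mem_Icc.mpr ⟨hq0, hx2⟩))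
    exact Finset.single_le_sum (f := fun a : ℕ => omg W δ q * (B^5 * (q:ℝ)^(-(5/2):ℝ)) * phi (B^2 * (α - a / q))) (fun a _ => hnn q a) (Finset.mem_range.mpr (by omega))
  have hker : ‖1 - KK W J α‖ * U^(-(5/4):ℝ) ≤ 2 * omg W δ q * U^(-(9/8):ℝ) := by
    unfold omg
    split_ifs with hd
    · have h2 := KK_small W J q hJ hq0 hd x.num α β hαe
      have h3 := min_rpow (2 * Real.pi * W * J * |β|) _ (by positivity) (KK_two W J hJ α) h2
      have h4 : 2 * Real.pi * W * J * |β| ≤ δ * U := by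
        have : 2 * Real.pi * W * J * |β| = δ * (B^2*|β|) := by rw [hδ]; field_simp
        rw [this]; gcongr; linarith
      have h5 : (2 * Real.pi * W * J * |β|)^((1/8):ℝ) ≤ (δ * U)^((1/8):ℝ) := by gcongr
      rw [Real.mul_rpow hδ0 hU0.le] at h5
      calc ‖1 - KK W J α‖ * U^(-(5/4):ℝ) ≤ (2 * (δ^((1/8):ℝ) * U^((1/8):ℝ))) * U^(-(5/4):ℝ) := by
            gcongr; linarith
        _ = 2 * δ^((1/8):ℝ) * (U^((1/8):ℝ) * U^(-(5/4):ℝ)) := by ring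
        _ = _ := by rw [← Real.rpow_add hU0]; norm_num
    · have h2 := KK_two W J hJ α
      have h3 : U^(-(5/4):ℝ) ≤ U^(-(9/8):ℝ) := Real.rpow_le_rpow_of_exponent_le hU1 (by norm_num)
      rw [mul_one]
      gcongr
  rw [norm_mul, norm_mul, ee_norm, mul_one]
  have hk2 := KK_two W J hJ α
  have hE : 0 ≤ √(EL A B)^5 := by positivity
  calc _ ≤ C2 A * ((B:ℝ)^5 * (q:ℝ)^(-(5/2):ℝ) * U^(-(5/4):ℝ) + √(EL A B)^5) * ‖1 - KK W J α‖ := by gcongr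
    _ = C2 A * ((B:ℝ)^5 * (q:ℝ)^(-(5/2):ℝ) * (‖1 - KK W J α‖ * U^(-(5/4):ℝ)) + √(EL A B)^5 * ‖1 - KK W J α‖) := by ring
    _ ≤ C2 A * ((B:ℝ)^5 * (q:ℝ)^(-(5/2):ℝ) * (2 * omg W δ q * U^(-(9/8):ℝ)) + √(EL A B)^5 * 2) := by gcongr
    _ = 2 * C2 A * (omg W δ q * (B^5 * (q:ℝ)^(-(5/2):ℝ)) * phi (B^2 * (α - a / q)) + √(EL A B)^5) := by
        rw [hphi]; ring
    _ ≤ _ := by gcongr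
end

section
open MeasureTheory

lemma phi_int : Integrable phi := by
  have := integrable_one_add_norm (E := ℝ) (μ := volume) (r := 9/8) (by simp; norm_num)
  exact this

lemma phi_cont : Continuous phi := by
  unfold phi
  refine Continuous.rpow_const (by fun_prop) ?_
  intro x; left; positivity

lemma phi_shift (B : ℝ) (hB : 0 < B) (s : ℝ) :
    ∫ α in (0:ℝ)..1, phi (B^2 * (α - s)) ≤ (∫ t, phi t) / B^2 := by
  have hB2 : B^2 ≠ 0 := by positivity
  have hi : Integrable (fun t => phi (B^2 * t)) := phi_int.comp_mul_left' hB2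
  have hi2 : Integrable (fun t => phi (B^2 * (t - s))) := hi.comp_sub_right s
  rw [intervalIntegral.integral_of_le zero_le_one]
  refine (setIntegral_le_integral hi2 (Filter.Eventually.of_forall fun t => phi_nonneg _)).trans ?_
  rw [integral_sub_right_eq_self (fun t => phi (B^2 * t)) s, Measure.integral_comp_mul_left]
  rw [abs_of_pos (by positivity), smul_eq_mul]
  apply le_of_eq; field_simp

theorem circle (A : ℕ) (hA : 0 < A) : ∃ C : ℝ, 0 < C ∧ ∀ (b c : Fin 5 → ℤ), (∀ i, 0 < b i) → (∀ i, 2 * b i ≤ A) →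
    ∀ B W J : ℕ, 0 < B → 0 < J → ∀ L : ℤ,
    |(rr b c B L : ℝ) - (1 / (J:ℝ)) * ∑ j ∈ Finset.range J, (rr b c B (L - W * j) : ℝ)| ≤
     C * ((B:ℝ)^3 * ((W * J / (B:ℝ)^2)^((1/8):ℝ) +
      ∑ q ∈ (Finset.Icc 1 (2 * (A * B))).filter (fun q => ¬ q ∣ W), (q:ℝ)^(-(3/2):ℝ)) + √(EL A B)^5) := by
  set I0 := ∫ t, phi t with hI0
  have hI0n : 0 ≤ I0 := integral_nonneg phi_nonneg
  have hsum : Summable (fun q : ℕ => (q:ℝ)^(-(3/2):ℝ)) := Real.summable_nat_rpow.mpr (by norm_num)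
  set Z := ∑' q : ℕ, (q:ℝ)^(-(3/2):ℝ) with hZ
  have hZ0 : 0 ≤ Z := tsum_nonneg (fun q => by positivity)
  have hC2 : 0 < C2 A := by unfold C2; positivity
  set P8 : ℝ := (2 * Real.pi)^((1/8):ℝ) with hP8
  refine ⟨2 * C2 A * (2 * I0 * (P8 * Z + 1) + 1), by positivity, ?_⟩
  intro b c hb hbA B W J hB hJ L
  have hBr : (0:ℝ) < B := by exact_mod_cast hB
  set δ : ℝ := 2 * Real.pi * W * J / B^2 with hδ
  have hδ0 : 0 ≤ δ := by positivity
  have hδe : δ^((1/8):ℝ) = P8 * (W * J / (B:ℝ)^2)^((1/8):ℝ) := by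
    rw [hP8, ← Real.mul_rpow (by positivity) (by positivity)]; congr 1; rw [hδ]; ring
  set δ8 := (W * J / (B:ℝ)^2)^((1/8):ℝ) with hδ8
  set S := ∑ q ∈ (Finset.Icc 1 (2 * (A * B))).filter (fun q => ¬ q ∣ W), (q:ℝ)^(-(3/2):ℝ) with hS
  have hom : ∀ q, 0 ≤ omg W δ q := by intro q; unfold omg; split_ifs <;> positivity
  set E5 := √(EL A B)^5 with hE5
  have hE5n : 0 ≤ E5 := by positivity
  have hS0 : 0 ≤ S := Finset.sum_nonneg (fun q _ => by positivity)
  have hcont : Continuous (fun α : ℝ => (∏ i, SS B (b i) (c i) α) * ee (-(α * L)) * (1 - KK W J α)) :=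
    ((continuous_finsetProd _ (fun i _ => SS_cont _ _ _)).mul (ee_cont.comp (by fun_prop))).mul (continuous_const.sub (KK_cont W J))
  have hpc : ∀ s : ℝ, Continuous (fun α : ℝ => phi (B^2 * (α - s))) := fun s => phi_cont.comp (by fun_prop)
  have h1 : ‖∫ α in (0:ℝ)..1, (∏ i, SS B (b i) (c i) α) * ee (-(α * L)) * (1 - KK W J α)‖ ≤
      ∫ α in (0:ℝ)..1, 2 * C2 A * ((∑ q ∈ Finset.Icc 1 (2 * (A * B)), ∑ a ∈ Finset.range (q+1),
        omg W δ q * (B^5 * (q:ℝ)^(-(5/2):ℝ)) * phi (B^2 * (α - a / q))) + E5) := by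
    apply intervalIntegral.norm_integral_le_of_norm_le zero_le_one
    · filter_upwards with α hα
      exact pt_bound b c A B W J hb hbA hA hB hJ α hα.1.le hα.2 L
    · apply Continuous.intervalIntegrable
      refine continuous_const.mul (Continuous.add ?_ continuous_const)
      exact continuous_finsetSum _ (fun q _ => continuous_finsetSum _ (fun a _ => continuous_const.mul (hpc _)))
  rw [int_main, Complex.norm_real, Real.norm_eq_abs] at h1
  refine h1.trans ?_
  rw [intervalIntegral.integral_const_mul, intervalIntegral.integral_add, intervalIntegral.integral_finsetSum]
  rotate_left
  · intro q _
    exact (continuous_finsetSum _ (fun a _ => continuous_const.mul (hpc _))).intervalIntegrable _ _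
  · exact (continuous_finsetSum _ (fun q _ => continuous_finsetSum _ (fun a _ => continuous_const.mul (hpc _)))).intervalIntegrable _ _
  · exact continuous_const.intervalIntegrable _ _
  have h2 : ∀ q ∈ Finset.Icc 1 (2 * (A * B)), ∫ α in (0:ℝ)..1, ∑ a ∈ Finset.range (q+1),
        omg W δ q * (B^5 * (q:ℝ)^(-(5/2):ℝ)) * phi (B^2 * (α - a / q)) ≤
        2 * I0 * B^3 * (omg W δ q * (q:ℝ)^(-(3/2):ℝ)) := by
    intro q hq
    have hq1 : 1 ≤ q := (Finset.mem_Icc.mp hq).1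
    have hqr : (1:ℝ) ≤ q := by exact_mod_cast hq1
    rw [intervalIntegral.integral_finsetSum]
    · simp_rw [intervalIntegral.integral_const_mul]
      have := hom q
      calc _ ≤ ∑ a ∈ Finset.range (q+1), omg W δ q * (B^5 * (q:ℝ)^(-(5/2):ℝ)) * (I0 / B^2) := by
            apply Finset.sum_le_sum
            intro a _
            gcongr
            exact phi_shift B hBr _
        _ = (q+1) * (omg W δ q * (B^3 * (q:ℝ)^(-(5/2):ℝ)) * I0) := by
            rw [Finset.sum_const, Finset.card_range, nsmul_eq_mul]; push_cast
            field_simp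
        _ ≤ (2 * q) * (omg W δ q * (B^3 * (q:ℝ)^(-(5/2):ℝ)) * I0) := by
            gcongr; linarith
        _ = 2 * I0 * B^3 * (omg W δ q * (q * (q:ℝ)^(-(5/2):ℝ))) := by ring
        _ = _ := by
            congr 2
            nth_rewrite 1 [← Real.rpow_one (q:ℝ)]
            rw [← Real.rpow_add (by linarith)]; norm_num
    · intro a _
      exact (continuous_const.mul (hpc _)).intervalIntegrable _ _
  have h3 : ∑ q ∈ Finset.Icc 1 (2 * (A * B)), omg W δ q * (q:ℝ)^(-(3/2):ℝ) ≤ P8 * δ8 * Z + S := by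
    rw [← Finset.sum_filter_add_sum_filter_not (Finset.Icc 1 (2 * (A * B))) (fun q => q ∣ W)]
    apply add_le_add
    · calc _ = ∑ q ∈ (Finset.Icc 1 (2 * (A * B))).filter (fun q => q ∣ W), P8 * δ8 * (q:ℝ)^(-(3/2):ℝ) := by
            apply Finset.sum_congr rfl
            intro q hq
            unfold omg
            rw [if_pos (Finset.mem_filter.mp hq).2, hδe]
        _ = P8 * δ8 * ∑ q ∈ (Finset.Icc 1 (2 * (A * B))).filter (fun q => q ∣ W), (q:ℝ)^(-(3/2):ℝ) := by rw [Finset.mul_sum]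
        _ ≤ _ := by
          gcongr
          exact hsum.sum_le_tsum _ (fun q _ => by positivity)
    · apply le_of_eq
      apply Finset.sum_congr rfl
      intro q hq
      unfold omg
      rw [if_neg (Finset.mem_filter.mp hq).2, one_mul]
  have hδ8n : 0 ≤ δ8 := by positivity
  have hP8n : 0 ≤ P8 := by positivity
  calc _ ≤ 2 * C2 A * (∑ q ∈ Finset.Icc 1 (2 * (A * B)), 2 * I0 * B^3 * (omg W δ q * (q:ℝ)^(-(3/2):ℝ)) + E5) := by
        gcongr with q hq
        · exact h2 q hq
        · simp
    _ = 2 * C2 A * (2 * I0 * B^3 * ∑ q ∈ Finset.Icc 1 (2 * (A * B)), (omg W δ q * (q:ℝ)^(-(3/2):ℝ)) + E5) := by rw [Finset.mul_sum]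
    _ ≤ 2 * C2 A * (2 * I0 * B^3 * (P8 * δ8 * Z + S) + E5) := by gcongr
    _ ≤ 2 * C2 A * ((2 * I0 * (P8 * Z + 1) + 1) * (B^3 * (δ8 + S) + E5)) := by
        have e : (2 * I0 * (P8 * Z + 1) + 1) * (B^3 * (δ8 + S) + E5) - (2 * I0 * B^3 * (P8 * δ8 * Z + S) + E5)
          = 2 * I0 * B^3 * δ8 + 2 * I0 * B^3 * (P8 * Z * S) + B^3 * (δ8 + S) + 2 * I0 * (P8 * Z + 1) * E5 := by ring
        have : 0 ≤ 2 * I0 * B^3 * δ8 + 2 * I0 * B^3 * (P8 * Z * S) + B^3 * (δ8 + S) + 2 * I0 * (P8 * Z + 1) * E5 := by positivity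
        gcongr
        linarith
    _ = _ := by ring
end

section
lemma g_up (b c S x : ℤ) (hb : 1 ≤ b) (hS : b + |c| ≤ S) (hx : 0 ≤ x) : b * x^2 + c * x ≤ S * x^2 := by
  have h1 : c * x ≤ |c| * x^2 := by
    have h2 : x ≤ x^2 := by nlinarith [Int.le_self_sq x]
    calc c * x ≤ |c| * x := by gcongr; exact le_abs_self c
      _ ≤ _ := by gcongr
  nlinarith [sq_nonneg x]

lemma g_lo (b c S x : ℤ) (hb : 1 ≤ b) (hS : b + |c| ≤ S) (hx : 0 ≤ x) : x^2 - S * x ≤ b * x^2 + c * x := by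
  have h1 : -(S * x) ≤ c * x := by
    have : -S ≤ c := by have := neg_abs_le c; linarith
    nlinarith
  nlinarith [sq_nonneg x]

set_option maxHeartbeats 1600000 in
lemma pick (b c S W r R P : ℤ) (hb : 1 ≤ b) (hS : b + |c| ≤ S) (hW : 0 < W) (hr : 0 ≤ r) (hrW : r < W)
    (hP : 12 * S * W ≤ P) (hR1 : P^2 ≤ 2 * R) (hR2 : R ≤ 7 * P^2) :
    ∃ x : ℤ, 0 ≤ x ∧ x < (S+4) * P ∧ W ∣ x - r ∧ 0 ≤ R - (b * x^2 + c * x) ∧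
      R - (b * x^2 + c * x) < W * (2 * S * (S+4) * P) := by
  have hc0 := abs_nonneg c
  have hS1 : 1 ≤ S := by linarith
  have hSW : 1 ≤ S * W := by nlinarith
  have hP1 : 12 ≤ P := by nlinarith
  have hPW : W ≤ P := by nlinarith
  have hR0 : 0 ≤ R := by nlinarith [sq_nonneg P]
  have hex : ∃ u : ℕ, R < b * (r + W * u)^2 + c * (r + W * u) := by
    refine ⟨(S + 1 + R).toNat, ?_⟩
    rw [Int.toNat_of_nonneg (by linarith)]
    set x := r + W * (S + 1 + R)
    have hx : S + 1 + R ≤ x := by simp only [x]; nlinarith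
    have := g_lo b c S x hb hS (by linarith)
    nlinarith
  classical
  set u0 := Nat.find hex with hu0
  have h1 := Nat.find_spec hex
  have h0 : u0 ≠ 0 := by
    intro h
    rw [← hu0, h] at h1
    simp only [Nat.cast_zero, mul_zero, add_zero] at h1
    have h2 := g_up b c S r hb hS hr
    have h3 : S * r^2 ≤ S * W^2 := by gcongr
    have h4 : S * W^2 * 144 ≤ P^2 := by
      have : (12 * S * W)^2 ≤ P^2 := by gcongr
      have h5 : S * W^2 ≤ S^2 * W^2 := by
        have : S ≤ S^2 := by nlinarith
        gcongr
      nlinarith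
    nlinarith [sq_nonneg P]
  obtain ⟨u, hu⟩ := Nat.exists_eq_succ_of_ne_zero h0
  have h2 : ¬ (R < b * (r + W * u)^2 + c * (r + W * u)) := Nat.find_min hex (by omega)
  rw [← hu0, hu] at h1
  push_cast at h1
  set x := r + W * u with hx
  have hx0 : 0 ≤ x := by positivity
  have h1' : R < b * (x+W)^2 + c * (x+W) := by
    have e : r + W * ((u:ℤ)+1) = x + W := by rw [hx]; ring
    rw [e] at h1; exact h1
  have hxP : x ≤ (S+3) * P := by
    by_contra hcon
    push Not at hcon
    have := g_lo b c S x hb hS hx0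
    have h3 : 3 * P < x - S := by nlinarith
    have h4 : 3 * P * (3 * P) ≤ x * (x - S) := by
      have : 3 * P ≤ x := by nlinarith
      nlinarith
    nlinarith [sq_nonneg P]
  push Not at h2
  refine ⟨x, hx0, by nlinarith, ⟨u, by rw [hx]; ring⟩, by linarith, ?_⟩
  have hc1 := le_abs_self c
  have h5 : R - (b * x^2 + c * x) < W * (2 * b * x + b * W + c) := by nlinarith
  refine lt_of_lt_of_le h5 ?_
  apply mul_le_mul_of_nonneg_left _ hW.le
  have hbS : b ≤ S := by linarith
  have h6 : b * x ≤ S * ((S+3) * P) := by gcongr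
  have h7 : b * W ≤ S * P := by gcongr
  have h8 : c ≤ S * P := by nlinarith
  nlinarith

set_option maxHeartbeats 1600000 in
theorem count (b c : Fin 5 → ℤ) (hb : ∀ i, 0 < b i) : ∃ S : ℕ, 0 < S ∧ ∀ W : ℕ, 0 < W → ∀ (L : ℤ) (P : ℕ),
    (P:ℤ)^2 ≤ L → L ≤ P^2 + 2 * P → 12 * S * W ≤ P →
    rho b c L W * (P / (6 * S * W))^4 ≤ ∑ j ∈ Finset.range (2 * S * (S+4) * P), rr b c ((S+4) * P) (L - W * j) := by
  obtain ⟨S, hS⟩ : ∃ S : ℕ, ∀ i, b i + |c i| ≤ S := by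
    refine ⟨(∑ i, (b i + |c i|)).toNat, fun i => ?_⟩
    have h : ∀ i, 0 ≤ b i + |c i| := fun i => by have := abs_nonneg (c i); have := hb i; linarith
    rw [Int.toNat_of_nonneg (Finset.sum_nonneg (fun i _ => h i))]
    exact Finset.single_le_sum (f := fun i => b i + |c i|) (fun i _ => h i) (Finset.mem_univ i)
  have hS1 : 0 < S := by
    have := hS 0; have := hb 0; have := abs_nonneg (c 0); omega
  refine ⟨S, hS1, ?_⟩
  intro W hW L P hL1 hL2 hP
  have : NeZero W := ⟨hW.ne'⟩
  set K := P / (6 * S * W) with hK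
  set J := 2 * S * (S+4) * P with hJ
  set B := (S+4) * P with hB
  have hKP : 6 * S * (W * K) ≤ P := by
    have := Nat.div_mul_le_self P (6 * S * W)
    rw [← hK] at this; nlinarith
  classical
  set T : Finset (Fin 5 → ℤ) := (Finset.range J).biUnion (fun j => (Fintype.piFinset (fun _ : Fin 5 => Finset.Ico (0:ℤ) B)).filter (fun x => qf b c x = L - W * j)) with hT
  have hTc : T.card ≤ ∑ j ∈ Finset.range J, rr b c B (L - W * j) := Finset.card_biUnion_le
  refine le_trans ?_ hTc
  have key : ∀ p : {x : Fin 5 → ZMod W // ∑ i, ((b i : ZMod W) * x i^2 + (c i : ZMod W) * x i) = (L : ZMod W)} × (Fin 4 → Fin K),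
      ∃ x : Fin 5 → ℤ, x ∈ T ∧ (∀ i, (x i : ZMod W) = p.1.1 i) ∧ ∀ i : Fin 4, x i.castSucc = ((p.1.1 i.castSucc).val : ℤ) + W * (p.2 i : ℕ) := by
    rintro ⟨⟨r, hr⟩, k⟩
    have hSz : (1:ℤ) ≤ S := by exact_mod_cast hS1
    have hPz : (12:ℤ) * S * W ≤ P := by exact_mod_cast hP
    have hWz : (1:ℤ) ≤ W := by exact_mod_cast hW
    set y : Fin 4 → ℤ := fun i => ((r i.castSucc).val : ℤ) + W * (k i : ℕ) with hy
    have hy0 : ∀ i, 0 ≤ y i := fun i => by simp only [hy]; positivity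
    have hyP : ∀ i, 6 * S * y i ≤ P := by
      intro i
      have h1 : (r i.castSucc).val < W := ZMod.val_lt _
      have h2 : ((k i : ℕ)) + 1 ≤ K := (k i).2
      have h3 : (r i.castSucc).val + W * (k i : ℕ) ≤ W * K := by
        calc _ ≤ W + W * (k i : ℕ) := by omega
          _ = W * ((k i : ℕ) + 1) := by ring
          _ ≤ _ := Nat.mul_le_mul_left _ h2
      have h4 : 6 * S * ((r i.castSucc).val + W * (k i : ℕ)) ≤ P := le_trans (Nat.mul_le_mul_left _ h3) hKP
      simp only [hy]
      exact_mod_cast h4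
    have hGu : ∀ i : Fin 4, 36 * (b i.castSucc * y i^2 + c i.castSucc * y i) ≤ P^2 := by
      intro i
      have h1 := g_up _ _ _ _ (hb i.castSucc) (hS i.castSucc) (hy0 i)
      have h2 : (6 * S * y i)^2 ≤ (P:ℤ)^2 := by
        have := hy0 i
        have := hyP i
        gcongr
      have h3 : S * y i^2 ≤ (S:ℤ)^2 * y i^2 := by
        have : (S:ℤ) ≤ S^2 := by nlinarith
        gcongr
      nlinarith
    have hGl : ∀ i : Fin 4, -(P:ℤ) ≤ (b i.castSucc * y i^2 + c i.castSucc * y i) := by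
      intro i
      have h1 := g_lo _ _ _ _ (hb i.castSucc) (hS i.castSucc) (hy0 i)
      have := hyP i
      have := hy0 i
      nlinarith [sq_nonneg (y i)]
    set Q : ℤ := ∑ i : Fin 4, (b i.castSucc * y i^2 + c i.castSucc * y i) with hQ
    have hQ1 : 9 * Q ≤ P^2 := by
      have := Finset.sum_le_sum (fun i (_ : i ∈ Finset.univ) => hGu i)
      rw [← Finset.mul_sum, ← hQ] at this
      simp at this
      linarith
    have hQ2 : -(4 * P) ≤ Q := by
      have := Finset.sum_le_sum (fun i (_ : i ∈ Finset.univ) => hGl i)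
      rw [← hQ] at this
      simp at this
      linarith
    have hP1 : (1:ℤ) ≤ P := by nlinarith
    obtain ⟨z, hz0, hzP, hzd, hz1, hz2⟩ := pick (b (Fin.last 4)) (c (Fin.last 4)) S W (r (Fin.last 4)).val (L - Q) P (hb _) (hS _) (by omega) (by positivity)
      (by exact_mod_cast ZMod.val_lt _) hPz (by nlinarith [sq_nonneg (P:ℤ)]) (by nlinarith)
    set x : Fin 5 → ℤ := Fin.snoc (α := fun _ => ℤ) y z with hx
    have hx1 : ∀ i : Fin 4, x i.castSucc = y i := fun i => by simp [hx]
    have hx2 : x (Fin.last 4) = z := by rw [hx]; exact Fin.snoc_last (α := fun _ => ℤ) z y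
    have hxr : ∀ i, (x i : ZMod W) = r i := by
      intro i
      refine Fin.lastCases ?_ (fun i => ?_) i
      · rw [hx2]
        have h1 : ((z - ((r (Fin.last 4)).val : ℤ) : ℤ) : ZMod W) = 0 := (ZMod.intCast_zmod_eq_zero_iff_dvd _ _).mpr hzd
        rw [Int.cast_sub, Int.cast_natCast] at h1
        rw [ZMod.natCast_zmod_val] at h1
        linear_combination h1
      · rw [hx1, hy]
        push_cast
        rw [ZMod.natCast_zmod_val, ZMod.natCast_self]; ring
    have hqf : qf b c x = Q + (b (Fin.last 4) * z^2 + c (Fin.last 4) * z) := by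
      unfold qf
      rw [Fin.sum_univ_castSucc, hx2, hQ]
      simp only [hx1]
    have hdiv : (W:ℤ) ∣ L - qf b c x := by
      rw [← ZMod.intCast_zmod_eq_zero_iff_dvd]
      unfold qf
      push_cast
      rw [← hr]
      simp only [hxr]; ring
    obtain ⟨j, hj⟩ := hdiv
    have hj0 : 0 ≤ j := by
      by_contra hcon
      push Not at hcon
      have : (W:ℤ) * j < 0 := by nlinarith
      rw [← hj, hqf] at this; linarith
    have hjJ : j < J := by
      have h1 : (W:ℤ) * j < W * J := by
        rw [← hj, hqf, hJ]
        simp only [Nat.cast_mul, Nat.cast_add, Nat.cast_ofNat]; linarith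
      exact lt_of_mul_lt_mul_left h1 (by omega)
    refine ⟨x, ?_, hxr, fun i => hx1 i⟩
    rw [hT, Finset.mem_biUnion]
    refine ⟨j.toNat, Finset.mem_range.mpr (by omega), ?_⟩
    rw [Finset.mem_filter, Fintype.mem_piFinset]
    constructor
    · intro i
      rw [Finset.mem_Ico]
      refine Fin.lastCases ?_ (fun i => ?_) i
      · rw [hx2, hB]; push_cast; exact ⟨hz0, hzP⟩
      · rw [hx1, hB]; push_cast
        have := hyP i
        have := hy0 i
        refine ⟨this, ?_⟩
        have h5 : y i ≤ S * y i := by nlinarith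
        have h6 : (0:ℤ) < S * P := by positivity
        nlinarith
    · rw [Int.toNat_of_nonneg hj0]; linarith
  choose f hf1 hf2 hf3 using key
  have hinj : Function.Injective (fun p => (⟨f p, hf1 p⟩ : T)) := by
    intro p p' h
    have h : f p = f p' := congrArg Subtype.val h
    have h1 : p.1 = p'.1 := by
      apply Subtype.ext
      funext i
      rw [← hf2, ← hf2, h]
    have h2 : p.2 = p'.2 := by
      funext i
      have e1 := hf3 p i
      have e2 := hf3 p' i
      rw [h, e2, h1] at e1
      have e3 : (W:ℤ) * (p'.2 i : ℕ) = W * (p.2 i : ℕ) := by linarith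
      have e4 := mul_left_cancel₀ (by exact_mod_cast hW.ne' : (W:ℤ) ≠ 0) e3
      apply Fin.ext
      exact_mod_cast e4.symm
    exact Prod.ext h1 h2
  have hcard := Nat.card_le_card_of_injective _ hinj
  rw [Nat.card_prod] at hcard
  simpa [rho, Nat.card_eq_fintype_card] using hcard
end

section
open Filter

lemma EL_le (A D : ℕ) (hA : 0 < A) (hD : 0 < D) : ∃ C3 : ℝ, 0 < C3 ∧ ∀ P : ℕ, 0 < P →
    √(EL A (D * P))^5 ≤ C3 * (P:ℝ)^((11/4):ℝ) := by
  set Y : ℝ := 20 * D * (2 * A * D)^((1/10):ℝ) with hY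
  have hAr : (1:ℝ) ≤ A := by exact_mod_cast hA
  have hDr : (1:ℝ) ≤ D := by exact_mod_cast hD
  have hY0 : 0 < Y := by positivity
  refine ⟨√Y^5, by positivity, ?_⟩
  intro P hP
  have hPr : (1:ℝ) ≤ P := by exact_mod_cast hP
  have h1 : EL A (D*P) ≤ Y * (P:ℝ)^((11/10):ℝ) := by
    unfold EL
    have hz : (1:ℝ) ≤ 2 * A * ((D*P : ℕ):ℝ) := by
      have : 1 ≤ 2 * A * (D*P) := Nat.mul_pos (by omega) (Nat.mul_pos hD hP)
      exact_mod_cast this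
    have h2 := Real.log_le_rpow_div (x := 2 * A * ((D*P : ℕ):ℝ)) (by linarith) (by norm_num : (0:ℝ) < 1/10)
    have h3 := Real.one_le_rpow hz (by norm_num : (0:ℝ) ≤ 1/10)
    have h4 : 1 + Real.log (2 * A * ((D*P : ℕ):ℝ)) ≤ 20 * (2 * A * ((D*P : ℕ):ℝ))^((1/10):ℝ) := by
      have : (2 * A * ((D*P : ℕ):ℝ))^((1/10):ℝ) / (1/10) = 10 * (2 * A * ((D*P : ℕ):ℝ))^((1/10):ℝ) := by ring
      linarith
    calc _ ≤ ((D*P : ℕ):ℝ) * (20 * (2 * A * ((D*P : ℕ):ℝ))^((1/10):ℝ)) := by gcongr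
      _ = ((D*P : ℕ):ℝ) * (20 * ((2 * A * D) * P)^((1/10):ℝ)) := by push_cast; congr 3; ring
      _ = Y * (P^(1:ℝ) * P^((1/10):ℝ)) := by
        rw [Real.mul_rpow (by positivity) (by positivity), hY, Real.rpow_one]; push_cast; ring
      _ = _ := by rw [← Real.rpow_add (by linarith)]; norm_num
  calc √(EL A (D * P))^5 ≤ √(Y * (P:ℝ)^((11/10):ℝ))^5 := by gcongr
    _ = √Y^5 * (P:ℝ)^((11/4):ℝ) := by
      rw [Real.sqrt_mul hY0.le, mul_pow]
      congr 1
      rw [Real.sqrt_eq_rpow, ← Real.rpow_mul (by positivity), ← Real.rpow_mul_natCast (by positivity)]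
      norm_num

set_option maxHeartbeats 800000 in
theorem five (b c : Fin 5 → ℤ) (hb : ∀ i, 0 < b i) : ∃ M : ℕ, 0 < M ∧ ∃ L0 : ℤ, ∀ L : ℤ, L0 ≤ L →
    (∃ x, (M:ℤ) ∣ qf b c x - L) → ∃ x : Fin 5 → ℤ, (∀ i, 0 ≤ x i) ∧ qf b c x = L := by
  obtain ⟨M, σ, hM, hσ, hrho⟩ := rho_lower b c (fun i => (hb i).ne')
  obtain ⟨S, hS, hcount⟩ := count b c hb
  obtain ⟨A, hA, hbA⟩ : ∃ A : ℕ, 0 < A ∧ ∀ i, 2 * b i ≤ A := by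
    have h : ∀ i, 2 * b i ≤ ∑ i, 2 * b i := fun i =>
      Finset.single_le_sum (f := fun i => 2 * b i) (fun i _ => by have := hb i; omega) (Finset.mem_univ i)
    have h0 := h 0
    have := hb 0
    refine ⟨(∑ i, 2 * b i).toNat, by omega, fun i => ?_⟩
    have := h i
    omega
  obtain ⟨C, hC, hcirc⟩ := circle A hA
  have hD : 0 < S + 4 := by omega
  obtain ⟨C3, hC3, hEL⟩ := EL_le A (S+4) hA hD
  set D : ℕ := S + 4 with hDdef
  have hSr : (0:ℝ) < S := by exact_mod_cast hS
  have hDr : (0:ℝ) < D := by exact_mod_cast hD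
  set c0 : ℝ := σ / ((12 * S)^4 * (2 * S * D)) with hc0
  have hc0p : 0 < c0 := by positivity
  set ε : ℝ := c0 / (4 * C * D^3) with hε
  have hεp : 0 < ε := by positivity
  obtain ⟨w, hw⟩ := tail_small ε hεp
  set W := w.factorial with hW
  have hWp : 0 < W := Nat.factorial_pos w
  have hWr : (0:ℝ) < W := by exact_mod_cast hWp
  have ht1 : Tendsto (fun P : ℕ => (2 * S * W / D * (P:ℝ)⁻¹)^((1/8):ℝ)) atTop (nhds 0) := by
    have h1 : Tendsto (fun P : ℕ => 2 * S * W / D * (P:ℝ)⁻¹) atTop (nhds 0) := by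
      have := tendsto_inv_atTop_nhds_zero_nat (𝕜 := ℝ)
      simpa using this.const_mul (2 * S * W / D : ℝ)
    have := h1.rpow_const (p := (1/8:ℝ)) (Or.inr (by norm_num))
    simpa using this
  have he1 := ht1.eventually (gt_mem_nhds hεp)
  have ht2 : Tendsto (fun P : ℕ => (P:ℝ)^((1/4):ℝ)) atTop atTop :=
    (tendsto_rpow_atTop (by norm_num)).comp tendsto_natCast_atTop_atTop
  have he2 := ht2.eventually_ge_atTop (C * C3 * 4 / c0)
  obtain ⟨P0, hP0⟩ := eventually_atTop.mp ((he1.and he2).and (eventually_ge_atTop (12 * S * W)))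
  refine ⟨M, hM, (P0:ℤ)^2, ?_⟩
  intro L hL hloc
  have hL0 : 0 ≤ L := le_trans (sq_nonneg _) hL
  obtain ⟨N, rfl⟩ := Int.eq_ofNat_of_zero_le hL0
  set P := Nat.sqrt N with hP
  have hPP0 : P0 ≤ P := by
    rw [hP, Nat.le_sqrt']
    exact_mod_cast hL
  obtain ⟨⟨e1, e2⟩, e3⟩ := hP0 P hPP0
  have hPpos : 0 < P := lt_of_lt_of_le (by positivity) e3
  have hPr : (0:ℝ) < P := by exact_mod_cast hPpos
  have hcnt := hcount W hWp N P (by exact_mod_cast Nat.sqrt_le' N)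
    (by have := Nat.sqrt_le_add N
        rw [← hP] at this
        have h2 : N ≤ P^2 + 2 * P := by nlinarith
        exact_mod_cast h2) e3
  have hr := hrho N hloc W hWp
  set J := 2 * S * D * P with hJ
  have hJp : 0 < J := by positivity
  have hBp : 0 < D * P := by positivity
  have hcc := hcirc b c hb hbA (D*P) W J hBp hJp N
  have hsum : ∑ q ∈ (Finset.Icc 1 (2 * (A * (D*P)))).filter (fun q => ¬ q ∣ W), (q:ℝ)^(-(3/2):ℝ) < ε := by
    apply hw
    intro q hq
    simp only [Finset.mem_filter, Finset.mem_Icc] at hq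
    by_contra hcon
    exact hq.2 (Nat.dvd_factorial hq.1.1 (by omega))
  have hδ : ((W:ℝ) * J / ((D*P : ℕ):ℝ)^2)^((1/8):ℝ) < ε := by
    have : (W:ℝ) * J / ((D*P : ℕ):ℝ)^2 = 2 * S * W / D * (P:ℝ)⁻¹ := by
      rw [hJ]; push_cast; field_simp
    rw [this]; exact e1
  have hE := hEL P hPpos
  have hE2 : C * √(EL A (D * P))^5 ≤ c0 / 4 * P^3 := by
    have h1 : C * C3 ≤ c0 / 4 * (P:ℝ)^((1/4):ℝ) := by
      rw [div_le_iff₀ hc0p] at e2; linarith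
    calc C * √(EL A (D * P))^5 ≤ C * (C3 * (P:ℝ)^((11/4):ℝ)) := by gcongr
      _ = (C * C3) * (P:ℝ)^((11/4):ℝ) := by ring
      _ ≤ (c0 / 4 * (P:ℝ)^((1/4):ℝ)) * (P:ℝ)^((11/4):ℝ) := by gcongr
      _ = c0 / 4 * ((P:ℝ)^((1/4):ℝ) * (P:ℝ)^((11/4):ℝ)) := by ring
      _ = c0 / 4 * P^3 := by
        rw [← Real.rpow_add hPr, ← Real.rpow_natCast]; norm_num
  -- lower bound of the average
  have hK : (P:ℝ) / (12 * S * W) ≤ ((P / (6 * S * W) : ℕ) : ℝ) := by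
    have hd : 0 < 6 * S * W := by positivity
    have h1 : P < (P / (6 * S * W) + 1) * (6 * S * W) := by
      have := Nat.lt_mul_div_succ P hd
      linarith
    have h2 : 2 ≤ P / (6 * S * W) := by
      rw [Nat.le_div_iff_mul_le hd]; linarith
    set K := P / (6 * S * W)
    have h3 : P ≤ K * (12 * S * W) := by nlinarith
    rw [div_le_iff₀ (by positivity)]
    exact_mod_cast h3
  have havg : c0 * P^3 ≤ (1 / (J:ℝ)) * ∑ j ∈ Finset.range J, (rr b c (D*P) ((N:ℤ) - W * j) : ℝ) := by
    have hcr : (rho b c N W : ℝ) * ((P / (6 * S * W) : ℕ) : ℝ)^4 ≤ ∑ j ∈ Finset.range J, (rr b c (D*P) ((N:ℤ) - W * j) : ℝ) := by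
      exact_mod_cast hcnt
    calc c0 * P^3 = (1 / (J:ℝ)) * (σ * W^4 * ((P:ℝ) / (12 * S * W))^4) := by
          rw [hc0, hJ]; push_cast; field_simp
      _ ≤ (1 / (J:ℝ)) * ((rho b c N W : ℝ) * ((P / (6 * S * W) : ℕ) : ℝ)^4) := by gcongr
      _ ≤ _ := by gcongr
  have hpos : (0:ℝ) < rr b c (D*P) N := by
    have h1 := (abs_le.mp hcc).1
    have h2 : C * ((((D*P : ℕ):ℝ))^3 * ((((W:ℝ) * J / ((D*P : ℕ):ℝ)^2)^((1/8):ℝ)) + ∑ q ∈ (Finset.Icc 1 (2 * (A * (D*P)))).filter (fun q => ¬ q ∣ W), (q:ℝ)^(-(3/2):ℝ))) < c0 / 2 * P^3 := by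
      have hp : 0 < C * ((D*P : ℕ):ℝ)^3 := by positivity
      calc _ = (C * ((D*P : ℕ):ℝ)^3) * ((((W:ℝ) * J / ((D*P : ℕ):ℝ)^2)^((1/8):ℝ)) + ∑ q ∈ (Finset.Icc 1 (2 * (A * (D*P)))).filter (fun q => ¬ q ∣ W), (q:ℝ)^(-(3/2):ℝ)) := by ring
        _ < (C * ((D*P : ℕ):ℝ)^3) * (ε + ε) := mul_lt_mul_of_pos_left (by linarith) hp
        _ = _ := by rw [hε]; push_cast; field_simp; ring
    rw [mul_add] at h1
    have h3 : 0 < c0 * (P:ℝ)^3 := by positivity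
    linarith
  have hpos' : 0 < rr b c (D*P) N := by exact_mod_cast hpos
  unfold rr at hpos'
  obtain ⟨x, hx⟩ := Finset.card_pos.mp hpos'
  rw [Finset.mem_filter, Fintype.mem_piFinset] at hx
  exact ⟨x, fun i => (Finset.mem_Ico.mp (hx.1 i)).1, hx.2⟩
end

lemma two_poly (m x : ℤ) : 2 * polyNum m x = (m - 2) * (x * (x - 1)) + 2 * x := by
  unfold polyNum
  have h : (2:ℤ) ∣ (m - 2) * (x * (x - 1)) := Dvd.dvd.mul_left (Int.even_mul_pred_self x).two_dvd _
  obtain ⟨k, hk⟩ := h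
  rw [hk, Int.mul_ediv_cancel_left _ (by norm_num)]
  ring

/-- any `m`-gonal form of rank `n ≥ 5` is almost regular over `ℕ₀`: only finitely
many positive integers are locally represented by `⟨a₁,…,aₙ⟩ₘ` yet not represented over `ℕ₀`. -/
theorem stmt18 (m : ℤ) (hm : 3 ≤ m) (n : ℕ) (hn : 5 ≤ n)
    (a : Fin n → ℤ) (ha : ∀ i, 0 < a i) :
    Set.Finite {N : ℤ | 0 < N ∧
      (∀ r : ℤ, 0 < r →
        ∃ x : Fin n → ℤ, (∑ i, a i * polyNum m (x i)) ≡ N [ZMOD r]) ∧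
      ¬ ∃ x : Fin n → ℕ, ∑ i, a i * polyNum m ((x i : ℤ)) = N} := by
  obtain ⟨k, rfl⟩ := Nat.exists_eq_add_of_le hn
  set b : Fin 5 → ℤ := fun i => a (Fin.castAdd k i) * (m - 2) with hb
  set c : Fin 5 → ℤ := fun i => a (Fin.castAdd k i) * (4 - m) with hc
  have hqf : ∀ x : Fin 5 → ℤ, qf b c x = 2 * ∑ i, a (Fin.castAdd k i) * polyNum m (x i) := by
    intro x
    unfold qf
    rw [Finset.mul_sum]
    apply Finset.sum_congr rfl
    intro i _
    have := two_poly m (x i)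
    simp only [hb, hc]
    linear_combination (-a (Fin.castAdd k i)) * this
  obtain ⟨M, hM, L0, hfive⟩ := five b c (fun i => mul_pos (ha _) (by omega))
  set E : ℤ := ∑ i : Fin k, ∑ y ∈ Finset.Ico (0:ℤ) M, |2 * (a (Fin.natAdd 5 i) * polyNum m y)| with hE
  have hE0 : 0 ≤ E := Finset.sum_nonneg (fun i _ => Finset.sum_nonneg (fun y _ => abs_nonneg _))
  refine (Set.finite_Ico (0:ℤ) (|L0| + E + 1)).subset ?_
  rintro N ⟨hN0, hloc, hrep⟩
  refine ⟨hN0.le, ?_⟩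
  by_contra hcon
  push Not at hcon
  apply hrep
  have hMz : (0:ℤ) < M := by exact_mod_cast hM
  obtain ⟨x, hx⟩ := hloc M hMz
  set z : Fin k → ℤ := fun i => x (Fin.natAdd 5 i) % M with hz
  have hz0 : ∀ i, 0 ≤ z i := fun i => Int.emod_nonneg _ hMz.ne'
  have hz1 : ∀ i, z i < M := fun i => Int.emod_lt_of_pos _ hMz
  set Tz : ℤ := ∑ i, 2 * (a (Fin.natAdd 5 i) * polyNum m (z i)) with hTz
  have hTE : Tz ≤ E := by
    apply Finset.sum_le_sum
    intro i _
    refine (le_abs_self _).trans ?_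
    exact Finset.single_le_sum (f := fun y => |2 * (a (Fin.natAdd 5 i) * polyNum m y)|) (fun y _ => abs_nonneg _)
      (Finset.mem_Ico.mpr ⟨hz0 i, hz1 i⟩)
  have hTx : (M:ℤ) ∣ Tz - ∑ i, 2 * (a (Fin.natAdd 5 i) * polyNum m (x (Fin.natAdd 5 i))) := by
    rw [hTz, ← Finset.sum_sub_distrib]
    apply Finset.dvd_sum
    intro i _
    have h1 : (M:ℤ) ∣ z i - x (Fin.natAdd 5 i) := by
      have := Int.emod_add_mul_ediv (x (Fin.natAdd 5 i)) M
      exact ⟨-(x (Fin.natAdd 5 i) / M), by simp only [hz]; linarith⟩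
    have e1 := two_poly m (z i)
    have e2 := two_poly m (x (Fin.natAdd 5 i))
    have e3 : 2 * (a (Fin.natAdd 5 i) * polyNum m (z i)) - 2 * (a (Fin.natAdd 5 i) * polyNum m (x (Fin.natAdd 5 i)))
      = (z i - x (Fin.natAdd 5 i)) * (a (Fin.natAdd 5 i) * ((m-2) * (z i + x (Fin.natAdd 5 i) - 1) + 2)) := by
      linear_combination (a (Fin.natAdd 5 i)) * e1 - (a (Fin.natAdd 5 i)) * e2
    rw [e3]
    exact Dvd.dvd.mul_right h1 _
  obtain ⟨y, hy0, hy⟩ := hfive (2 * N - Tz) (by have := le_abs_self L0; have := abs_nonneg L0; linarith) (by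
    refine ⟨fun i => x (Fin.castAdd k i), ?_⟩
    rw [hqf]
    have h1 : (M:ℤ) ∣ N - ∑ i, a i * polyNum m (x i) := hx.dvd
    rw [Fin.sum_univ_add] at h1
    rw [← Finset.mul_sum] at hTx
    have h2 := hTx.sub (Dvd.dvd.mul_left h1 2)
    exact h2.trans (dvd_of_eq (by ring)))
  refine ⟨Fin.addCases (fun i => (y i).toNat) (fun i => (z i).toNat), ?_⟩
  rw [Fin.sum_univ_add]
  simp only [Fin.addCases_left, Fin.addCases_right, Int.toNat_of_nonneg (hy0 _), Int.toNat_of_nonneg (hz0 _)]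
  rw [hqf] at hy
  rw [← Finset.mul_sum] at hTz
  linarith
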